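/- Let n ≥ 2 and let G₁,…,G_n be nontrivial finitely generated groups with finite generating sets S₁,…,S_n, and let p_c be the critical probability of the Cayley graph of the free product G₁*…*G_n with respect to S₁ ⊔ … ⊔ S_n. Then for every p with 0 ≤ p < p_c all χᵢ(p) are finite, the quantity D(p) = Σ_{j=1}^n Π_{i≠j} χᵢ(p) − (n−1)·Π_{i=1}^n χᵢ(p) is strictly positive, and the expected cluster size of the identity in the Cayley graph of G₁*…*G_n equals Π_{i=1}^n χᵢ(p) / D(p); moreover for every p with p_c ≤ p ≤ 1 the expected cluster size is infinite. -/

import Mathlib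

open MeasureTheory ENNReal

namespace Perc

/-- Percolation configurations on the edge set `E`: each edge is `true` (open) or
`false` (closed). -/
abbrev Config (E : Type*) := E → Bool

/-- `μ` is the Bernoulli product measure `P_p` with parameter `p` on `{0,1}^E`: the measure
of every finite cylinder event is the corresponding product.  (This determines `μ` uniquely
on the product σ-algebra, since cylinders form a π-system generating it.) -/
def IsBernoulli {E : Type*} (p : ℝ) (μ : Measure (Config E)) : Prop :=
  ∀ (F : Finset E) (σ : E → Bool),
    μ {ω | ∀ e ∈ F, ω e = σ e} =
      ∏ e ∈ F, ENNReal.ofReal (if σ e then p else 1 - p)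

variable {G ι : Type*} [Group G]

/-- In the Cayley graph of `G` with edge set `G × ι`, where the edge `(a, i)` joins `a` and
`a * f i` (the function `f : ι → G` lists the generators, with multiplicity), this says that
vertices `a` and `b` are joined by some open edge of the configuration `ω`. -/
def Step (f : ι → G) (ω : Config (G × ι)) (a b : G) : Prop :=
  ∃ i : ι, (ω (a, i) = true ∧ b = a * f i) ∨ (ω (b, i) = true ∧ a = b * f i)

/-- `x` and `y` are connected by a path of open edges (`x ↔ y`). -/
def Conn (f : ι → G) (ω : Config (G × ι)) (x y : G) : Prop :=
  Relation.ReflTransGen (Step f ω) x y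

/-- The open cluster `C` of the identity. -/
def cluster (f : ι → G) (ω : Config (G × ι)) : Set G :=
  {x | Conn f ω 1 x}

/-- The percolation function `θ`: the probability that the cluster of the identity is
infinite. -/
noncomputable def theta (f : ι → G) (μ : Measure (Config (G × ι))) : ℝ :=
  (μ {ω | (cluster f ω).Infinite}).toReal

/-- The expected cluster size `χ = E(|C|) ∈ [0,∞]` (where `|C| ∈ ℕ∞` is coerced
to `ℝ≥0∞`). -/
noncomputable def chi (f : ι → G) (μ : Measure (Config (G × ι))) : ℝ≥0∞ :=
  ∫⁻ ω, ((cluster f ω).encard : ℝ≥0∞) ∂μ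

/-- The critical probability `p_c = inf {p ∈ [0,1] | θ(p) > 0}`, with the convention
`p_c = 1` if `θ` vanishes on `[0,1]`; here `μ p` is the percolation measure at
parameter `p`. -/
noncomputable def pc (f : ι → G) (μ : ℝ → Measure (Config (G × ι))) : ℝ :=
  sInf ({p | p ∈ Set.Icc (0 : ℝ) 1 ∧ 0 < theta f (μ p)} ∪ {1})

/-- The word metric on `G` with respect to the generators `f i`: the length of a shortest
word in the generators and their inverses taking `x` to `y`.  (When the generators generate
`G`, this is the graph distance in the Cayley graph.) -/
noncomputable def wdist (f : ι → G) (x y : G) : ℕ :=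
  sInf {n : ℕ | ∃ l : List G, l.length = n ∧
    (∀ g ∈ l, (∃ i, f i = g) ∨ (∃ i, (f i)⁻¹ = g)) ∧ x * l.prod = y}

/-- Schonmann's critical point
`p_exp = sup {p ∈ [0,1] | ∃ c > 0, γ > 0, ∀ x y, P_p(x ↔ y) ≤ c·exp(-γ·dist(x,y))}`. -/
noncomputable def pexp (f : ι → G) (μ : ℝ → Measure (Config (G × ι))) : ℝ :=
  sSup {p | p ∈ Set.Icc (0 : ℝ) 1 ∧ ∃ c > 0, ∃ γ > 0, ∀ x y : G,
    (μ p {ω | Conn f ω x y}).toReal ≤ c * Real.exp (-γ * (wdist f x y : ℝ))}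

/-- The walk-through function `g(p,t) = 1 - ∑_{n≥1} (1-t)^{n-1} P_p(|C| = n)` of a Cayley
graph; here `μ` is the percolation measure at parameter `p`. -/
noncomputable def wt (f : ι → G) (μ : Measure (Config (G × ι))) (t : ℝ) : ℝ :=
  1 - ∑' n : ℕ, (1 - t) ^ n * (μ {ω | (cluster f ω).encard = ((n + 1 : ℕ) : ℕ∞)}).toReal

/-- The ball of radius `j`: all products of at most `j` elements of `S ∪ S⁻¹`. -/
def ball (S : Set G) (j : ℕ) : Set G :=
  {g | ∃ l : List G, l.length ≤ j ∧ (∀ x ∈ l, x ∈ S ∨ x⁻¹ ∈ S) ∧ l.prod = g}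

/-- The Cheeger constant `h = inf_K |∂K| / |K|`, the infimum over nonempty finite vertex
sets `K` of the number of edges `(a, i)` (joining `a` and `a * f i`) with exactly one
endpoint in `K`, divided by `|K|`. -/
noncomputable def cheeger (f : ι → G) : ℝ :=
  ⨅ K : {K : Finset G // K.Nonempty},
    (Nat.card {e : G × ι // Xor' (e.1 ∈ K.1) (e.1 * f e.2 ∈ K.1)} : ℝ) / (K.1.card : ℝ)

/-- The open cluster of the identity in the subgraph induced on the vertex set `V`: only
open edges with both endpoints in `V` may be used. -/
def clusterIn (f : ι → G) (V : Set G) (ω : Config (G × ι)) : Set G :=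
  {x | Relation.ReflTransGen (fun a b => Step f ω a b ∧ a ∈ V ∧ b ∈ V) 1 x}

/-- The generators of `G` given by a generating set `S` (one edge orbit per element
of `S`). -/
def setGens (S : Set G) : S → G := Subtype.val

/-- The generators of the free product `G₁ * G₂` given by the disjoint union `S₁ ⊔ S₂` of
generating sets, embedded via the canonical monomorphisms. -/
def coprodGens {G₁ G₂ : Type*} [Group G₁] [Group G₂] (S₁ : Set G₁) (S₂ : Set G₂) :
    S₁ ⊕ S₂ → Monoid.Coprod G₁ G₂ :=
  Sum.elim (fun s => Monoid.Coprod.inl (s : G₁)) (fun s => Monoid.Coprod.inr (s : G₂))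

/-- The generators of the free product `G₁ * ⋯ * G_n` given by the disjoint union
`S₁ ⊔ ⋯ ⊔ S_n` of generating sets, embedded via the canonical monomorphisms. -/
def coprodIGens {n : ℕ} {G : Fin n → Type*} [∀ i, Group (G i)] (S : ∀ i, Set (G i)) :
    (Σ i, S i) → Monoid.CoprodI G :=
  fun x => Monoid.CoprodI.of (x.2 : G x.1)

/-- The image of a list of syllables in the free product `G₁ * G₂`. -/
def sylProd {G₁ G₂ : Type*} [Group G₁] [Group G₂] (l : List (G₁ ⊕ G₂)) :
    Monoid.Coprod G₁ G₂ :=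
  (l.map (Sum.elim (fun g => Monoid.Coprod.inl g) (fun h => Monoid.Coprod.inr h))).prod

/-- The set `P₁` of nontrivial elements of `G₁ * G₂` whose normal form begins with a
nontrivial syllable of `G₁`: elements represented by a nonempty alternating product of
nontrivial syllables, the first syllable lying in `G₁`.  (Such a representation is the
normal form, which is unique.) -/
def beginsLeft {G₁ G₂ : Type*} [Group G₁] [Group G₂] (x : Monoid.Coprod G₁ G₂) : Prop :=
  ∃ l : List (G₁ ⊕ G₂), l ≠ [] ∧ (∀ a ∈ l, a ≠ Sum.inl 1 ∧ a ≠ Sum.inr 1) ∧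
    l.Chain' (fun a b => a.isLeft ≠ b.isLeft) ∧
    (∃ g : G₁, l.head? = some (Sum.inl g)) ∧ sylProd l = x

/-- The set `P₂` of nontrivial elements of `G₁ * G₂` whose normal form begins with a
nontrivial syllable of `G₂`. -/
def beginsRight {G₁ G₂ : Type*} [Group G₁] [Group G₂] (x : Monoid.Coprod G₁ G₂) : Prop :=
  ∃ l : List (G₁ ⊕ G₂), l ≠ [] ∧ (∀ a ∈ l, a ≠ Sum.inl 1 ∧ a ≠ Sum.inr 1) ∧
    l.Chain' (fun a b => a.isLeft ≠ b.isLeft) ∧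
    (∃ h : G₂, l.head? = some (Sum.inr h)) ∧ sylProd l = x

end Perc

namespace Perc

open scoped Function
open ProbabilityTheory Set

section Bernoulli

variable {E E' : Type*}

/-- The Bernoulli law on `Bool` with parameter `p`. -/
noncomputable def boolLaw (p : ℝ) : Measure Bool :=
  ENNReal.ofReal p • Measure.dirac true + ENNReal.ofReal (1 - p) • Measure.dirac false

lemma boolLaw_singleton (p : ℝ) (b : Bool) :
    boolLaw p {b} = ENNReal.ofReal (if b then p else 1 - p) := by
  cases b <;> simp [boolLaw]

lemma isProbabilityMeasure_boolLaw {p : ℝ} (hp : p ∈ Icc (0 : ℝ) 1) :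
    IsProbabilityMeasure (boolLaw p) := by
  constructor
  have h : ENNReal.ofReal p + ENNReal.ofReal (1 - p) = 1 := by
    rw [← ENNReal.ofReal_add hp.1 (by linarith [hp.2])]
    simp
  simpa [boolLaw] using h

/-- The elementary cylinders determined by finitely many edges. -/
def cylinders (E : Type*) : Set (Set (Config E)) :=
  {A | ∃ (F : Finset E) (σ : E → Bool), A = {ω | ∀ e ∈ F, ω e = σ e}}

lemma isPiSystem_cylinders : IsPiSystem (cylinders E) := by
  classical
  rintro _ ⟨F, σ, rfl⟩ _ ⟨F', σ', rfl⟩ ⟨τ, hτ, hτ'⟩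
  refine ⟨F ∪ F', τ, ?_⟩
  ext ω
  simp only [mem_inter_iff, mem_ofPred_eq, Finset.mem_union] at hτ hτ' ⊢
  constructor
  · rintro ⟨h, h'⟩ e (he | he)
    · rw [h e he, hτ e he]
    · rw [h' e he, hτ' e he]
  · intro h
    exact ⟨fun e he => by rw [h e (.inl he), hτ e he],
      fun e he => by rw [h e (.inr he), hτ' e he]⟩

lemma measurableSet_open (e : E) (b : Bool) : MeasurableSet {ω : Config E | ω e = b} :=
  measurableSet_eq_fun (measurable_pi_apply e) measurable_const

lemma generateFrom_cylinders :
    (MeasurableSpace.pi : MeasurableSpace (Config E)) =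
      MeasurableSpace.generateFrom (cylinders E) := by
  apply le_antisymm
  · refine iSup_le fun e => ?_
    rw [← measurable_iff_comap_le]
    refine @measurable_to_bool _ (MeasurableSpace.generateFrom (cylinders E)) _ ?_
    exact MeasurableSpace.measurableSet_generateFrom
      ⟨{e}, fun _ => true, by ext ω; simp⟩
  · refine MeasurableSpace.generateFrom_le ?_
    rintro _ ⟨F, σ, rfl⟩
    rw [show {ω : Config E | ∀ e ∈ F, ω e = σ e} = ⋂ e ∈ F, {ω | ω e = σ e} by ext; simp]
    exact F.measurableSet_biInter fun e _ => measurableSet_open e _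

variable {p : ℝ} {μ ν : Measure (Config E)}

lemma IsBernoulli.isProbabilityMeasure (h : IsBernoulli p μ) : IsProbabilityMeasure μ :=
  ⟨by simpa using h ∅ fun _ => true⟩

lemma IsBernoulli.eq (h : IsBernoulli p μ) (h' : IsBernoulli p ν) : μ = ν := by
  have := h.isProbabilityMeasure
  have := h'.isProbabilityMeasure
  refine ext_of_generate_finite _ generateFrom_cylinders isPiSystem_cylinders ?_ (by simp)
  rintro _ ⟨F, σ, rfl⟩
  rw [h, h']

lemma isBernoulli_infinitePi (hp : p ∈ Icc (0 : ℝ) 1) :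
    haveI := isProbabilityMeasure_boolLaw hp
    IsBernoulli p (Measure.infinitePi fun _ : E => boolLaw p) := by
  have := isProbabilityMeasure_boolLaw hp
  intro F σ
  have := Measure.infinitePi_pi (μ := fun _ : E => boolLaw p) (s := F) (t := fun e => {σ e})
    (fun _ _ => measurableSet_singleton _)
  simp only [boolLaw_singleton] at this
  rw [← this]
  congr 1

lemma IsBernoulli.measure_open (h : IsBernoulli p μ) (e : E) :
    μ {ω | ω e = true} = ENNReal.ofReal p := by
  simpa using h {e} fun _ => true

lemma IsBernoulli.measure_closed (h : IsBernoulli p μ) (e : E) :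
    μ {ω | ω e = false} = ENNReal.ofReal (1 - p) := by
  simpa using h {e} fun _ => false

/-- Pulling back Bernoulli percolation along an injection of edge sets. -/
lemma IsBernoulli.map_comp (h : IsBernoulli p μ) {φ : E' → E} (hφ : φ.Injective) :
    IsBernoulli p (μ.map fun ω => ω ∘ φ) := by
  intro F σ
  have hm : MeasurableSet {ω : Config E' | ∀ e ∈ F, ω e = σ e} := by
    rw [generateFrom_cylinders]
    exact MeasurableSpace.measurableSet_generateFrom ⟨F, σ, rfl⟩
  rw [Measure.map_apply (by fun_prop) hm]
  have := h (F.map ⟨φ, hφ⟩) (Function.extend φ σ fun _ => true)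
  simpa [hφ.extend_apply] using this

/-- The configuration in which all edges outside `T` are closed. -/
noncomputable def cut (T : Set E) (ω : Config E) : Config E :=
  open Classical in fun e => if e ∈ T then ω e else false

@[simp] lemma cut_eq_true {T : Set E} {ω : Config E} {e : E} :
    cut T ω e = true ↔ e ∈ T ∧ ω e = true := by
  simp [cut]

lemma cut_congr {T : Set E} {ω ω' : Config E} (h : ∀ e ∈ T, ω e = ω' e) : cut T ω = cut T ω' := by
  ext e
  by_cases he : e ∈ T <;> simp [cut, he, h]

lemma cut_le (T : Set E) (ω : Config E) : cut T ω ≤ ω := by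
  intro e
  by_cases h : e ∈ T <;> simp [cut, h]

lemma cut_le_cut {T T' : Set E} {ω ω' : Config E} (hT : T ⊆ T') (hω : ω ≤ ω') :
    cut T ω ≤ cut T' ω' := by
  intro e
  by_cases h : e ∈ T
  · simpa [cut, h, hT h] using hω e
  · simp [cut, h]

lemma measurable_cut (T : Set E) : Measurable (cut T) := by
  refine measurable_pi_lambda _ fun e => ?_
  by_cases he : e ∈ T
  · simpa [cut, he] using measurable_pi_apply e
  · simp [cut, he]

/-- The event `A` is determined by the states of the edges in `T`. -/
def Determined (A : Set (Config E)) (T : Set E) : Prop := DependsOn (· ∈ A) T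

lemma Determined.mem_iff {A : Set (Config E)} {T : Set E} (h : Determined A T) {ω ω' : Config E}
    (hω : ∀ e ∈ T, ω e = ω' e) : ω ∈ A ↔ ω' ∈ A :=
  iff_of_eq (h hω)

lemma Determined.mono {A : Set (Config E)} {T T' : Set E} (h : Determined A T) (hT : T ⊆ T') :
    Determined A T' :=
  fun _ _ hω => h fun e he => hω e (hT he)

lemma Determined.inter {A B : Set (Config E)} {T : Set E} (h : Determined A T)
    (h' : Determined B T) : Determined (A ∩ B) T :=
  fun _ _ hω => propext (and_congr (h.mem_iff hω) (h'.mem_iff hω))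

lemma determined_cut (T : Set E) (P : Config E → Prop) : Determined {ω | P (cut T ω)} T := by
  intro ω ω' h
  simp [cut_congr h]

lemma determined_of_cut {T : Set E} {A : Set (Config E)} (h : ∀ ω, ω ∈ A ↔ cut T ω ∈ A) :
    Determined A T := by
  intro ω ω' h'
  simp only [eq_iff_iff]
  rw [h, h ω', cut_congr h']

lemma determined_open (e : E) (b : Bool) : Determined {ω | ω e = b} {e} := by
  intro ω ω' h
  simp [h e rfl]

lemma Determined.measurableSet {A : Set (Config E)} {T : Set E} (h : Determined A T)
    (hA : MeasurableSet A) :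
    MeasurableSet[⨆ e ∈ T, MeasurableSpace.comap (fun ω : Config E => ω e) inferInstance] A := by
  have hcut : cut T ⁻¹' A = A := by
    ext ω
    exact h.mem_iff fun e he => by simp [cut, he]
  rw [← hcut]
  refine (?_ : @Measurable _ _
    (⨆ e ∈ T, MeasurableSpace.comap (fun ω : Config E => ω e) inferInstance) _ (cut T)) hA
  refine @measurable_pi_lambda _ _ _ (_) _ _ fun e => ?_
  by_cases he : e ∈ T
  · simp only [cut, he, if_true]
    exact measurable_iff_comap_le.2 (le_iSup₂_of_le e he le_rfl)
  · simp only [cut, he, if_false]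
    exact measurable_const

lemma IsBernoulli.measure_inter (h : IsBernoulli p μ) (hp : p ∈ Icc (0 : ℝ) 1)
    {A B : Set (Config E)} {T T' : Set E} (hA : Determined A T) (hB : Determined B T')
    (hAm : MeasurableSet A) (hBm : MeasurableSet B) (hT : Disjoint T T') :
    μ (A ∩ B) = μ A * μ B := by
  have := isProbabilityMeasure_boolLaw hp
  rw [h.eq (isBernoulli_infinitePi hp)]
  have hind : iIndep (fun e : E => MeasurableSpace.comap (fun ω : Config E => ω e) inferInstance)
      (Measure.infinitePi fun _ : E => boolLaw p) :=
    iIndepFun_infinitePi (P := fun _ : E => boolLaw p) (X := fun _ ω => ω) fun _ => measurable_id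
  have := indep_iSup_of_disjoint (fun e => (measurable_pi_apply e).comap_le) hind hT
  exact (Indep_iff _ _ _).1 this A B (hA.measurableSet hAm) (hB.measurableSet hBm)

end Bernoulli

section Russo

variable {E : Type*} {p : ℝ} {μ : ℝ → Measure (Config E)}

/-- The set of configurations that belong to `A` once the state of the edge `e` is set to `b`. -/
noncomputable def pin (e : E) (b : Bool) (A : Set (Config E)) : Set (Config E) :=
  open Classical in {ω | Function.update ω e b ∈ A}

lemma measurableSet_pin {A : Set (Config E)} (hA : MeasurableSet A) (e : E) (b : Bool) :
    MeasurableSet (pin e b A) := by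
  classical
  have : Measurable fun ω : Config E => Function.update ω e b := by
    refine measurable_pi_lambda _ fun e' => ?_
    by_cases h : e' = e
    · subst h; simp
    · simpa [h] using measurable_pi_apply e'
  convert! this hA

lemma determined_pin_compl (e : E) (b : Bool) (A : Set (Config E)) :
    Determined (pin e b A) {e}ᶜ := by
  classical
  intro ω ω' h
  have : Function.update ω e b = Function.update ω' e b := by
    ext e'
    by_cases he : e' = e
    · subst he; simp
    · simp [he, h e' he]
  simp [pin, this]

lemma Determined.pin {A : Set (Config E)} {e : E} {T : Set E} (h : Determined A (insert e T))
    (b : Bool) : Determined (pin e b A) T := by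
  classical
  intro ω ω' hω
  refine h fun e' he' => ?_
  by_cases he : e' = e
  · subst he; simp
  · simpa [he] using hω e' (he'.resolve_left he)

lemma pin_comm {e e' : E} (h : e ≠ e') (b b' : Bool) (A : Set (Config E)) :
    pin e b (pin e' b' A) = pin e' b' (pin e b A) := by
  classical
  ext ω
  simp [pin, Function.update_comm h]

lemma IsBernoulli.measureReal_eq_pin {μ : Measure (Config E)} (h : IsBernoulli p μ)
    (hp : p ∈ Icc (0 : ℝ) 1) {A : Set (Config E)} (hA : MeasurableSet A) (e : E) :
    μ.real A = p * μ.real (pin e true A) + (1 - p) * μ.real (pin e false A) := by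
  classical
  have := h.isProbabilityMeasure
  have key : ∀ b, μ.real (A ∩ {ω | ω e = b}) =
      μ.real {ω | ω e = b} * μ.real (pin e b A) := by
    intro b
    have h1 : A ∩ {ω | ω e = b} = {ω | ω e = b} ∩ pin e b A := by
      ext ω
      simp only [mem_inter_iff, mem_ofPred_eq, pin]
      refine ⟨fun ⟨h1, h2⟩ => ⟨h2, ?_⟩, fun ⟨h1, h2⟩ => ⟨?_, h1⟩⟩
      · rwa [← h2, Function.update_eq_self]
      · rwa [← h1, Function.update_eq_self] at h2
    rw [h1, Measure.real, h.measure_inter hp (determined_open e b) (determined_pin_compl e b A)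
      (measurableSet_open e b) (measurableSet_pin hA e b) (by simp), ENNReal.toReal_mul]
    rfl
  have hcompl : A \ {ω | ω e = true} = A ∩ {ω | ω e = false} := by
    ext ω
    simp
  rw [← measureReal_inter_add_sdiff (measurableSet_open e true), hcompl, key, key,
    measureReal_def, h.measure_open, measureReal_def μ {ω : Config E | ω e = false},
    h.measure_closed, ENNReal.toReal_ofReal hp.1, ENNReal.toReal_ofReal (by linarith [hp.2])]

/-- **Russo's formula**, for events depending on finitely many edges. -/
theorem hasDerivWithinAt_measureReal (hμ : ∀ p ∈ Icc (0 : ℝ) 1, IsBernoulli p (μ p))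
    (F : Finset E) {A : Set (Config E)} (hA : MeasurableSet A) (hF : Determined A F)
    (hp : p ∈ Icc (0 : ℝ) 1) :
    HasDerivWithinAt (fun q => (μ q).real A)
      (∑ e ∈ F, ((μ p).real (pin e true A) - (μ p).real (pin e false A))) (Icc 0 1) p := by
  classical
  induction F using Finset.induction generalizing A with
  | empty =>
    have : A = ∅ ∨ A = univ := by
      rcases A.eq_empty_or_nonempty with h | ⟨ω, hω⟩
      · exact .inl h
      · exact .inr (eq_univ_of_forall fun ω' => (hF.mem_iff (by simp)).1 hω)
    rw [Finset.sum_empty]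
    rcases this with rfl | rfl
    · simpa using hasDerivWithinAt_const p (Icc (0 : ℝ) 1) (0 : ℝ)
    · refine (hasDerivWithinAt_const p (Icc (0 : ℝ) 1) (1 : ℝ)).congr (fun q hq => ?_) ?_
      · have := (hμ q hq).isProbabilityMeasure
        simp
      · have := (hμ p hp).isProbabilityMeasure
        simp
  | insert a F ha ih =>
    rw [Finset.coe_insert] at hF
    have h1 := ih (measurableSet_pin hA a true) (hF.pin true)
    have h0 := ih (measurableSet_pin hA a false) (hF.pin false)
    have hid := hasDerivWithinAt_id p (Icc (0 : ℝ) 1)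
    have hder := (hid.mul h1).add ((hid.const_sub 1).mul h0)
    refine (hder.congr (fun q hq => ?_) ?_).congr_deriv ?_
    · simpa using (hμ q hq).measureReal_eq_pin hq hA a
    · simpa using (hμ p hp).measureReal_eq_pin hp hA a
    · have hsum : ∑ e ∈ F, ((μ p).real (pin e true A) - (μ p).real (pin e false A)) =
          p * ∑ e ∈ F, ((μ p).real (pin e true (pin a true A)) -
            (μ p).real (pin e false (pin a true A))) +
          (1 - p) * ∑ e ∈ F, ((μ p).real (pin e true (pin a false A)) -
            (μ p).real (pin e false (pin a false A))) := by
        rw [Finset.mul_sum, Finset.mul_sum, ← Finset.sum_add_distrib]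
        refine Finset.sum_congr rfl fun e he => ?_
        have hea : e ≠ a := fun h => ha (h ▸ he)
        rw [(hμ p hp).measureReal_eq_pin hp (measurableSet_pin hA e true) a,
          (hμ p hp).measureReal_eq_pin hp (measurableSet_pin hA e false) a,
          pin_comm hea, pin_comm hea, pin_comm hea, pin_comm hea]
        ring
      rw [Finset.sum_insert ha, hsum]
      simp only [id]
      ring

lemma pin_false_subset_pin_true {A : Set (Config E)} (hA : IsUpperSet A) (e : E) :
    pin e false A ⊆ pin e true A := by
  classical
  intro ω hω
  exact hA (update_le_update_iff.2 ⟨by simp, fun _ _ => le_rfl⟩) hω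

lemma monotoneOn_measureReal (hμ : ∀ p ∈ Icc (0 : ℝ) 1, IsBernoulli p (μ p))
    {F : Finset E} {A : Set (Config E)} (hA : MeasurableSet A) (hF : Determined A F)
    (hup : IsUpperSet A) : MonotoneOn (fun q => (μ q).real A) (Icc 0 1) := by
  have hder := fun p hp => hasDerivWithinAt_measureReal (p := p) hμ F hA hF hp
  refine monotoneOn_of_hasDerivWithinAt_nonneg (convex_Icc 0 1)
    (fun p hp => (hder p hp).continuousWithinAt)
    (fun p hp => (hder p (interior_subset hp)).mono interior_subset) fun p hp => ?_
  have := (hμ p (interior_subset hp)).isProbabilityMeasure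
  exact Finset.sum_nonneg fun e _ =>
    sub_nonneg.2 (measureReal_mono (pin_false_subset_pin_true hup e))

end Russo

section Graph

variable {G ι : Type*} [Group G] {f : ι → G} {ω ω' : Config (G × ι)} {p : ℝ}
  {μ : Measure (Config (G × ι))}

/-- The edge `e` joins `a` and `b`. -/
def Joins (f : ι → G) (e : G × ι) (a b : G) : Prop :=
  (a = e.1 ∧ b = e.1 * f e.2) ∨ (b = e.1 ∧ a = e.1 * f e.2)

lemma step_iff {a b : G} : Step f ω a b ↔ ∃ e, ω e = true ∧ Joins f e a b := by
  constructor
  · rintro ⟨i, ⟨h, h'⟩ | ⟨h, h'⟩⟩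
    · exact ⟨(a, i), h, .inl ⟨rfl, h'⟩⟩
    · exact ⟨(b, i), h, .inr ⟨rfl, h'⟩⟩
  · rintro ⟨⟨c, i⟩, h, ⟨rfl, h'⟩ | ⟨rfl, h'⟩⟩
    · exact ⟨i, .inl ⟨h, h'⟩⟩
    · exact ⟨i, .inr ⟨h, h'⟩⟩

lemma Step.mono {a b : G} (h : Step f ω a b) (hω : ω ≤ ω') : Step f ω' a b := by
  obtain ⟨e, he, hj⟩ := step_iff.1 h
  exact step_iff.2 ⟨e, Bool.eq_true_of_true_le (he ▸ hω e), hj⟩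

lemma Conn.mono {a b : G} (h : Conn f ω a b) (hω : ω ≤ ω') : Conn f ω' a b :=
  Relation.ReflTransGen.mono (fun _ _ h => Step.mono h hω) _ _ h

lemma measurableSet_conn [Countable G] [Countable ι] (x y : G) :
    MeasurableSet {ω | Conn f ω x y} := by
  have hstep : ∀ a b : G, MeasurableSet {ω : Config (G × ι) | Step f ω a b} := by
    intro a b
    simp only [step_iff, ofPred_exists]
    exact .iUnion fun e => (measurableSet_open e true).inter (.const _)
  have hchain : ∀ (l : List G), MeasurableSet {ω : Config (G × ι) | l.IsChain (Step f ω)} := by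
    intro l
    induction l with
    | nil => simp
    | cons a l ih =>
      cases l with
      | nil => simp
      | cons b l =>
        simp only [List.isChain_cons_cons]
        exact (hstep a b).inter ih
  have h : ∀ ω, Conn f ω x y ↔
      ∃ l : List G, (x :: l).IsChain (Step f ω) ∧ (x :: l).getLast (by simp) = y :=
    fun ω => ⟨List.exists_isChain_cons_of_relationReflTransGen,
      fun ⟨l, h, h'⟩ => List.relationReflTransGen_of_exists_isChain_cons l h h'⟩
  simp only [h, ofPred_exists]
  exact .iUnion fun l => (hchain _).inter (.const _)

/-- The action of `G` on configurations by left translation of the edges. -/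
def shift (g : G) (ω : Config (G × ι)) : Config (G × ι) :=
  ω ∘ fun e => (g * e.1, e.2)

lemma conn_shift {g x y : G} : Conn f (shift g ω) x y ↔ Conn f ω (g * x) (g * y) := by
  have hstep : ∀ (g : G) (ω : Config (G × ι)) (a b : G),
      Step f (shift g ω) a b → Step f ω (g * a) (g * b) := by
    rintro g ω a b ⟨i, ⟨h, rfl⟩ | ⟨h, rfl⟩⟩
    · exact ⟨i, .inl ⟨h, by simp [mul_assoc]⟩⟩
    · exact ⟨i, .inr ⟨h, by simp [mul_assoc]⟩⟩
  have hconn : ∀ (g : G) (ω : Config (G × ι)) (x y : G),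
      Conn f (shift g ω) x y → Conn f ω (g * x) (g * y) := fun g ω x y h =>
    Relation.ReflTransGen.lift (g * ·) (hstep g ω) _ _ h
  refine ⟨hconn g ω x y, fun h => ?_⟩
  have h' : shift g⁻¹ (shift g ω) = ω := by
    ext e
    simp [shift]
  rw [← h'] at h
  simpa using hconn _ _ _ _ h

lemma IsBernoulli.measure_conn_mul [Countable G] [Countable ι] (h : IsBernoulli p μ) (g x y : G) :
    μ {ω | Conn f ω (g * x) (g * y)} = μ {ω | Conn f ω x y} := by
  have hinj : Function.Injective fun e : G × ι => (g * e.1, e.2) := by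
    rintro ⟨a, i⟩ ⟨b, j⟩ h
    simpa using h
  conv_rhs => rw [← (h.map_comp hinj).eq h,
    Measure.map_apply (by fun_prop) (measurableSet_conn x y)]
  congr 1
  ext ω
  exact conn_shift.symm

lemma chi_eq_tsum [Countable G] [Countable ι] :
    chi f μ = ∑' x, μ {ω | Conn f ω 1 x} := by
  have h : ∀ ω : Config (G × ι), ((cluster f ω).encard : ℝ≥0∞) =
      ∑' x, {ω | Conn f ω 1 x}.indicator (fun _ => 1) ω := by
    intro ω
    rw [← ENNReal.tsum_set_one, tsum_subtype (cluster f ω) fun _ => (1 : ℝ≥0∞)]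
    rfl
  simp only [chi, h]
  rw [lintegral_tsum fun x => (measurable_const.indicator (measurableSet_conn 1 x)).aemeasurable]
  exact tsum_congr fun x => by
    rw [lintegral_indicator_const (measurableSet_conn 1 x), one_mul]

end Graph

section Criterion

variable {G ι : Type*} [Group G] {f : ι → G} {p : ℝ} {μ : Measure (Config (G × ι))}

/-- The edges with both endpoints in `S`. -/
def innerEdges (f : ι → G) (S : Set G) : Set (G × ι) := {e | e.1 ∈ S ∧ e.1 * f e.2 ∈ S}

/-- The edges with an endpoint in `S`. -/
def touchingEdges (f : ι → G) (S : Set G) : Set (G × ι) := {e | e.1 ∈ S ∨ e.1 * f e.2 ∈ S}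

lemma Joins.mem_innerEdges_iff {e : G × ι} {a b : G} (h : Joins f e a b) (S : Set G) :
    e ∈ innerEdges f S ↔ a ∈ S ∧ b ∈ S := by
  obtain ⟨rfl, rfl⟩ | ⟨rfl, rfl⟩ := h
  · rfl
  · exact and_comm

lemma Joins.mem_touchingEdges_iff {e : G × ι} {a b : G} (h : Joins f e a b) (S : Set G) :
    e ∈ touchingEdges f S ↔ a ∈ S ∨ b ∈ S := by
  obtain ⟨rfl, rfl⟩ | ⟨rfl, rfl⟩ := h
  · rfl
  · exact or_comm

lemma finite_touchingEdges [Finite ι] (S : Finset G) : (touchingEdges f S).Finite := by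
  have h : touchingEdges f S ⊆ ((S : Set G) ×ˢ univ) ∪
      (fun e : G × ι => (e.1 * (f e.2)⁻¹, e.2)) '' ((S : Set G) ×ˢ univ) := by
    rintro ⟨a, i⟩ (h | h)
    · exact .inl ⟨h, mem_univ _⟩
    · exact .inr ⟨(a * f i, i), ⟨h, mem_univ _⟩, by simp⟩
  have hS := S.finite_toSet.prod (finite_univ (α := ι))
  exact (hS.union (hS.image _)).subset h

lemma step_cut_iff {T : Set (G × ι)} {ω : Config (G × ι)} {a b : G} :
    Step f (cut T ω) a b ↔ ∃ e ∈ T, ω e = true ∧ Joins f e a b := by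
  simp [step_iff, and_assoc]

/-- Some endpoint of `e` in `S` is connected to the identity inside `S`, and the other endpoint
of `e` is not in `S`. -/
def exitEvent (f : ι → G) (S : Set G) (e : G × ι) : Set (Config (G × ι)) :=
  {ω | ∃ y z, Joins f e y z ∧ y ∈ S ∧ z ∉ S ∧ Conn f (cut (innerEdges f S) ω) 1 y}

/-- The expected number of open edges leaving `S` from the cluster of the identity in `S`. -/
noncomputable def exitSum [Finite ι] (f : ι → G) (μ : Measure (Config (G × ι))) (p : ℝ)
    (S : Finset G) : ℝ :=
  p * ∑ e ∈ (finite_touchingEdges (f := f) S).toFinset, μ.real (exitEvent f S e)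

lemma measurableSet_conn_cut [Countable G] [Countable ι] (T : Set (G × ι)) (x y : G) :
    MeasurableSet {ω | Conn f (cut T ω) x y} :=
  measurable_cut T (measurableSet_conn x y)

lemma measurableSet_exitEvent [Countable G] [Countable ι] (S : Set G) (e : G × ι) :
    MeasurableSet (exitEvent f S e) := by
  simp only [exitEvent, ofPred_exists]
  refine .iUnion fun y => .iUnion fun z => ?_
  exact (MeasurableSet.const _).inter <| (MeasurableSet.const _).inter <|
    (MeasurableSet.const _).inter <| measurableSet_conn_cut _ _ _

lemma determined_exitEvent (S : Set G) (e : G × ι) :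
    Determined (exitEvent f S e) (innerEdges f S) :=
  determined_cut _ fun ω => ∃ y z, Joins f e y z ∧ y ∈ S ∧ z ∉ S ∧ Conn f ω 1 y

/-- A path from `a` to a vertex outside `C` either avoids `C`, or crosses an edge leaving `C`
after which it avoids `C`. -/
lemma Conn.last_exit {ω : Config (G × ι)} {a x : G} (h : Conn f ω a x) {C : Set G} (hx : x ∉ C) :
    (a ∉ C ∧ Conn f (cut (innerEdges f Cᶜ) ω) a x) ∨
      ∃ e y z, ω e = true ∧ Joins f e y z ∧ y ∈ C ∧ z ∉ C ∧
        Conn f (cut (innerEdges f Cᶜ) ω) z x := by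
  induction h using Relation.ReflTransGen.head_induction_on with
  | refl => exact .inl ⟨hx, .refl⟩
  | @head a b hab _ ih =>
    rcases ih with ⟨hb, hbx⟩ | h
    · obtain ⟨e, he, hj⟩ := step_iff.1 hab
      by_cases ha : a ∈ C
      · exact .inr ⟨e, a, b, he, hj, ha, hb, hbx⟩
      · exact .inl ⟨ha, hbx.head (step_cut_iff.2 ⟨e, (hj.mem_innerEdges_iff _).2 ⟨ha, hb⟩, he, hj⟩)⟩
    · exact .inr h

/-- The cluster of the identity inside `S` is `C`. -/
def innerClusterEq (f : ι → G) (S C : Set G) : Set (Config (G × ι)) :=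
  {ω | ∀ y, y ∈ C ↔ Conn f (cut (innerEdges f S) ω) 1 y}

lemma measurableSet_innerClusterEq [Countable G] [Countable ι] (S C : Set G) :
    MeasurableSet (innerClusterEq f S C) := by
  simp only [innerClusterEq, ofPred_forall]
  exact .iInter fun y => (MeasurableSet.const _).iff (measurableSet_conn_cut _ _ _)

lemma cut_cut {E : Type*} (T T' : Set E) (ω : Config E) : cut T (cut T' ω) = cut (T ∩ T') ω := by
  ext e
  by_cases h : e ∈ T <;> by_cases h' : e ∈ T' <;> simp [cut, h, h']

lemma determined_innerClusterEq (S C : Set G) :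
    Determined (innerClusterEq f S C) (innerEdges f S ∩ touchingEdges f C) := by
  refine determined_of_cut fun ω => ?_
  simp only [innerClusterEq, mem_ofPred_eq, cut_cut]
  rw [← inter_assoc, inter_self]
  have hle : cut (innerEdges f S ∩ touchingEdges f C) ω ≤ cut (innerEdges f S) ω :=
    cut_le_cut inter_subset_left le_rfl
  have hstep : ∀ {y z}, y ∈ C → Step f (cut (innerEdges f S) ω) y z →
      Step f (cut (innerEdges f S ∩ touchingEdges f C) ω) y z := by
    intro y z hy h
    obtain ⟨e, heS, he, hj⟩ := step_cut_iff.1 h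
    exact step_cut_iff.2 ⟨e, ⟨heS, (hj.mem_touchingEdges_iff C).2 (.inl hy)⟩, he, hj⟩
  constructor
  · intro h y
    refine ⟨fun hy => ?_, fun hy => (h y).2 (hy.mono hle)⟩
    replace hy := (h y).1 hy
    induction hy with
    | refl => exact .refl
    | tail hab hbc ih => exact ih.tail (hstep ((h _).2 hab) hbc)
  · intro h y
    refine ⟨fun hy => ((h y).1 hy).mono hle, fun hy => ?_⟩
    rw [h]
    induction hy with
    | refl => exact .refl
    | tail hab hbc ih => exact ih.tail (hstep ((h _).2 ih) hbc)

lemma mem_of_conn_innerEdges {S : Set G} {ω : Config (G × ι)} {x y : G} (hx : x ∈ S)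
    (h : Conn f (cut (innerEdges f S) ω) x y) : y ∈ S := by
  induction h with
  | refl => exact hx
  | tail _ hbc _ =>
    obtain ⟨e, heS, -, hj⟩ := step_cut_iff.1 hbc
    exact ((hj.mem_innerEdges_iff S).1 heS).2

open Classical in
/-- The endpoint outside `S` of an edge leaving `S`. -/
noncomputable def outerEnd (f : ι → G) (S : Set G) (e : G × ι) : G :=
  if e.1 ∈ S then e.1 * f e.2 else e.1

lemma Joins.outerEnd_eq {S : Set G} {e : G × ι} {y z : G} (h : Joins f e y z) (hy : y ∈ S)
    (hz : z ∉ S) : outerEnd f S e = z := by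
  obtain ⟨rfl, rfl⟩ | ⟨rfl, rfl⟩ := h
  · simp [outerEnd, hy]
  · simp [outerEnd, hz]

lemma exitSum_nonneg [Finite ι] (hp : 0 ≤ p) (S : Finset G) : 0 ≤ exitSum f μ p S :=
  mul_nonneg hp <| Finset.sum_nonneg fun _ _ => measureReal_nonneg

variable [Countable G] [Finite ι]

lemma IsBernoulli.measureReal_conn_mul (h : IsBernoulli p μ) (g x y : G) :
    μ.real {ω | Conn f ω (g * x) (g * y)} = μ.real {ω | Conn f ω x y} := by
  simp only [Measure.real, h.measure_conn_mul]

/-- The Simon–Lieb type inequality for a finite set `S` containing the identity. -/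
lemma IsBernoulli.measureReal_conn_le (h : IsBernoulli p μ) (hp : p ∈ Icc (0 : ℝ) 1)
    {S : Finset G} (hS : 1 ∈ S) {x : G} (hx : x ∉ S) :
    μ.real {ω | Conn f ω 1 x} ≤ ∑ e ∈ (finite_touchingEdges (f := f) S).toFinset,
      p * μ.real (exitEvent f S e) * μ.real {ω | Conn f ω (outerEnd f S e) x} := by
  classical
  have := h.isProbabilityMeasure
  let good (e : G × ι) : Finset (Finset G) :=
    {C ∈ S.powerset | ∃ y z, Joins f e y z ∧ y ∈ C ∧ z ∉ S}
  let ev (e : G × ι) (C : Finset G) : Set (Config (G × ι)) :=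
    innerClusterEq f S C ∩ ({ω | ω e = true} ∩
      {ω | Conn f (cut (innerEdges f (C : Set G)ᶜ) ω) (outerEnd f S e) x})
  have hsub : {ω | Conn f ω 1 x} ⊆
      ⋃ e ∈ (finite_touchingEdges (f := f) S).toFinset, ⋃ C ∈ good e, ev e C := by
    intro ω hω
    let C : Finset G := {y ∈ S | Conn f (cut (innerEdges f S) ω) 1 y}
    have hC : ∀ y, y ∈ C ↔ Conn f (cut (innerEdges f S) ω) 1 y := fun y => by
      simp only [C, Finset.mem_filter, and_iff_right_iff_imp]
      exact mem_of_conn_innerEdges (S := (S : Set G)) hS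
    have hCS : C ⊆ S := Finset.filter_subset _ _
    rcases Conn.last_exit hω (C := C) (fun hxC => hx (hCS hxC)) with
      ⟨h1, -⟩ | ⟨e, y, z, he, hj, hy, hz, hzx⟩
    · exact absurd ((hC 1).2 .refl) h1
    · have hzS : z ∉ (S : Set G) := fun hzS => hz <| (hC z).2 <| ((hC y).1 hy).tail <|
        step_cut_iff.2 ⟨e, (hj.mem_innerEdges_iff _).2 ⟨hCS hy, hzS⟩, he, hj⟩
      simp only [mem_iUnion]
      refine ⟨e, ?_, C, ?_, hC, he, ?_⟩
      · simpa using (hj.mem_touchingEdges_iff _).2 (.inl (hCS hy))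
      · simp only [good, Finset.mem_filter, Finset.mem_powerset]
        exact ⟨hCS, y, z, hj, hy, hzS⟩
      · show Conn f _ (outerEnd f S e) x
        rwa [hj.outerEnd_eq (hCS hy) hzS]
  have hev : ∀ e, ∀ C ∈ good e, μ.real (ev e C) ≤
      μ.real (innerClusterEq f S C) * (p * μ.real {ω | Conn f ω (outerEnd f S e) x}) := by
    intro e C hC
    simp only [good, Finset.mem_filter, Finset.mem_powerset] at hC
    obtain ⟨hCS, y, z, hj, hy, hz⟩ := hC
    have hopen : Determined {ω : Config (G × ι) | ω e = true}
        ({e} ∪ innerEdges f (C : Set G)ᶜ) :=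
      (determined_open e true).mono subset_union_left
    have hconn : Determined {ω | Conn f (cut (innerEdges f (C : Set G)ᶜ) ω) (outerEnd f S e) x}
        ({e} ∪ innerEdges f (C : Set G)ᶜ) :=
      (determined_cut _ fun ω => Conn f ω (outerEnd f S e) x).mono subset_union_right
    have hd : Disjoint (innerEdges f S ∩ touchingEdges f C)
        ({e} ∪ innerEdges f (C : Set G)ᶜ) := by
      rw [Set.disjoint_left]
      rintro e' ⟨h1, h2⟩ (rfl | h3)
      · exact hz ((hj.mem_innerEdges_iff _).1 h1).2
      · exact h2.elim h3.1 h3.2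
    have hd' : Disjoint ({e} : Set (G × ι)) (innerEdges f (C : Set G)ᶜ) := by
      rw [Set.disjoint_singleton_left]
      intro h3
      exact ((hj.mem_innerEdges_iff _).1 h3).1 hy
    have hmc := measurableSet_conn_cut (f := f) (innerEdges f (C : Set G)ᶜ) (outerEnd f S e) x
    simp only [ev, Measure.real]
    rw [h.measure_inter hp (determined_innerClusterEq _ _) (hopen.inter hconn)
        (measurableSet_innerClusterEq _ _) ((measurableSet_open e true).inter hmc) hd,
      h.measure_inter hp (determined_open e true)
        (determined_cut _ fun ω => Conn f ω (outerEnd f S e) x) (measurableSet_open e true)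
        hmc hd', ENNReal.toReal_mul, ENNReal.toReal_mul, h.measure_open,
      ENNReal.toReal_ofReal hp.1]
    have hp0 := hp.1
    gcongr
    · exact measure_ne_top _ _
    · exact fun hc => hc.mono (cut_le _ _)
  have hgood : ∀ e, ∑ C ∈ good e, μ.real (innerClusterEq f S C) ≤ μ.real (exitEvent f S e) := by
    intro e
    rw [← measureReal_biUnion_finset _ fun C _ => measurableSet_innerClusterEq _ _]
    · refine measureReal_mono (iUnion₂_subset fun C hC ω hω => ?_)
      simp only [good, Finset.mem_filter, Finset.mem_powerset] at hC
      obtain ⟨hCS, y, z, hj, hy, hz⟩ := hC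
      exact ⟨y, z, hj, hCS hy, hz, (hω y).1 hy⟩
    · intro C _ C' _ hne
      refine Set.disjoint_left.2 fun ω hω hω' => hne ?_
      ext y
      exact (hω y).trans (hω' y).symm
  calc μ.real {ω | Conn f ω 1 x}
      ≤ ∑ e ∈ (finite_touchingEdges (f := f) S).toFinset, ∑ C ∈ good e, μ.real (ev e C) :=
        (measureReal_mono hsub (measure_ne_top _ _)).trans <|
          (measureReal_biUnion_finset_le _ _).trans <|
          Finset.sum_le_sum fun e _ => measureReal_biUnion_finset_le _ _
    _ ≤ _ := by
        refine Finset.sum_le_sum fun e _ => (Finset.sum_le_sum (hev e)).trans ?_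
        rw [← Finset.sum_mul]
        calc _ ≤ μ.real (exitEvent f S e) * (p * μ.real {ω | Conn f ω (outerEnd f S e) x}) :=
              mul_le_mul_of_nonneg_right (hgood e) (mul_nonneg hp.1 measureReal_nonneg)
          _ = _ := by ring


lemma IsBernoulli.sum_measureReal_conn_le (h : IsBernoulli p μ) (hp : p ∈ Icc (0 : ℝ) 1)
    {S : Finset G} (hS : 1 ∈ S) (hlt : exitSum f μ p S < 1) (A : Finset G) :
    ∑ x ∈ A, μ.real {ω | Conn f ω 1 x} ≤ S.card / (1 - exitSum f μ p S) := by
  classical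
  have := h.isProbabilityMeasure
  set φ := exitSum f μ p S with hφ
  have hφ0 : 0 ≤ φ := exitSum_nonneg hp.1 S
  set M : ℝ := S.card / (1 - φ) with hM
  have hMeq : S.card + φ * M = M := by
    have : 1 - φ ≠ 0 := by linarith
    rw [hM]
    field_simp
    ring
  have hM0 : 0 ≤ M := div_nonneg (by positivity) (by linarith)
  have hcard : ∀ B : Finset G, ∑ x ∈ B, μ.real {ω | Conn f ω 1 x} ≤ B.card := fun B =>
    (Finset.sum_le_sum fun x _ => measureReal_le_one).trans (by simp)
  have key : ∀ (k N : ℕ) (B : Finset G), B.card ≤ N →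
      ∑ x ∈ B, μ.real {ω | Conn f ω 1 x} ≤ M + φ ^ k * N := by
    intro k N
    induction k with
    | zero =>
      intro B hB
      have : (B.card : ℝ) ≤ N := by exact_mod_cast hB
      linarith [hcard B]
    | succ k ih =>
      intro B hB
      have h1 : ∑ x ∈ B with x ∈ S, μ.real {ω | Conn f ω 1 x} ≤ S.card := by
        refine (hcard _).trans ?_
        exact_mod_cast Finset.card_le_card fun x hx => (Finset.mem_filter.1 hx).2
      have htrans : ∀ z, ∑ x ∈ B with x ∉ S, μ.real {ω | Conn f ω z x} ≤ M + φ ^ k * N := by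
        intro z
        calc _ = ∑ x ∈ ({x ∈ B | x ∉ S}).image (z⁻¹ * ·), μ.real {ω | Conn f ω 1 x} := by
              rw [Finset.sum_image fun x _ y _ hxy => mul_left_cancel hxy]
              refine Finset.sum_congr rfl fun x _ => ?_
              rw [← h.measureReal_conn_mul z⁻¹ z x, inv_mul_cancel]
          _ ≤ _ := ih _ (Finset.card_image_le.trans ((Finset.card_filter_le _ _).trans hB))
      have h2 : ∑ x ∈ B with x ∉ S, μ.real {ω | Conn f ω 1 x} ≤ φ * (M + φ ^ k * N) := by
        calc _ ≤ ∑ x ∈ B with x ∉ S, ∑ e ∈ (finite_touchingEdges (f := f) S).toFinset,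
              p * μ.real (exitEvent f S e) * μ.real {ω | Conn f ω (outerEnd f S e) x} :=
              Finset.sum_le_sum fun x hx =>
                h.measureReal_conn_le hp hS (Finset.mem_filter.1 hx).2
          _ ≤ ∑ e ∈ (finite_touchingEdges (f := f) S).toFinset,
              p * μ.real (exitEvent f S e) * (M + φ ^ k * N) := by
              rw [Finset.sum_comm]
              refine Finset.sum_le_sum fun e _ => ?_
              rw [← Finset.mul_sum]
              exact mul_le_mul_of_nonneg_left (htrans _) (mul_nonneg hp.1 measureReal_nonneg)
          _ = _ := by rw [← Finset.sum_mul, ← Finset.mul_sum, hφ, exitSum]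
      rw [← Finset.sum_filter_add_sum_filter_not B (· ∈ S)]
      calc _ ≤ S.card + φ * (M + φ ^ k * N) := add_le_add h1 h2
        _ = M + φ ^ (k + 1) * N := by rw [mul_add, ← add_assoc, hMeq]; ring
  have hlim : Filter.Tendsto (fun k : ℕ => M + φ ^ k * A.card) Filter.atTop
      (nhds (M + 0 * A.card)) :=
    ((tendsto_pow_atTop_nhds_zero_of_lt_one hφ0 hlt).mul_const _).const_add _
  rw [zero_mul, add_zero] at hlim
  exact ge_of_tendsto' hlim fun k => key k _ A le_rfl

lemma IsBernoulli.chi_ne_top_of_exitSum_lt_one (h : IsBernoulli p μ) (hp : p ∈ Icc (0 : ℝ) 1)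
    {S : Finset G} (hS : 1 ∈ S) (hlt : exitSum f μ p S < 1) : chi f μ ≠ ⊤ := by
  have := h.isProbabilityMeasure
  rw [chi_eq_tsum]
  refine ne_top_of_le_ne_top (ofReal_ne_top (r := S.card / (1 - exitSum f μ p S))) ?_
  rw [ENNReal.tsum_eq_iSup_sum]
  refine iSup_le fun A => ?_
  rw [Finset.sum_congr rfl fun x _ => (ofReal_measureReal (μ := μ) (s := {ω | Conn f ω 1 x})).symm,
    ← ENNReal.ofReal_sum_of_nonneg fun _ _ => measureReal_nonneg]
  exact ENNReal.ofReal_le_ofReal (h.sum_measureReal_conn_le hp hS hlt A)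

lemma IsBernoulli.exists_exitSum_lt_one (h : IsBernoulli p μ) (hp : p ∈ Icc (0 : ℝ) 1)
    (hχ : chi f μ ≠ ⊤) : ∃ S : Finset G, 1 ∈ S ∧ exitSum f μ p S < 1 := by
  classical
  have := h.isProbabilityMeasure
  have := Fintype.ofFinite ι
  rw [chi_eq_tsum] at hχ
  have hsum : Summable fun x => μ.real {ω | Conn f ω 1 x} :=
    ENNReal.summable_toReal hχ
  set ε : ℝ := 1 / (2 * Fintype.card ι + 1) with hε
  have hε0 : 0 < ε := by positivity
  obtain ⟨K₀, hK₀⟩ := summable_iff_vanishing_norm.1 hsum ε hε0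
  let K := insert 1 K₀
  let S : Finset G := K ∪ (K ×ˢ Finset.univ).image (fun e : G × ι => e.1 * f e.2) ∪
    (K ×ˢ Finset.univ).image (fun e : G × ι => e.1 * (f e.2)⁻¹)
  have h1 : (1 : G) ∈ S := by simp [S, K]
  have hKS : ∀ {e : G × ι} {y z}, Joins f e y z → y ∈ K → z ∈ S := by
    rintro e y z (⟨rfl, rfl⟩ | ⟨rfl, rfl⟩) hy
    · exact Finset.mem_union_left _ <| Finset.mem_union_right _ <|
        Finset.mem_image.2 ⟨e, by simpa using hy, rfl⟩
    · exact Finset.mem_union_right _ <|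
        Finset.mem_image.2 ⟨(e.1 * f e.2, e.2), by simpa using hy, by simp⟩
  let g : G → ℝ := fun y => if y ∈ K then 0 else μ.real {ω | Conn f ω 1 y}
  have hg0 : ∀ y, 0 ≤ g y := fun y => by
    by_cases hy : y ∈ K <;> simp [g, hy]
  have hgsum : ∀ B : Finset G, ∑ y ∈ B, g y ≤ ε := by
    intro B
    have hd : Disjoint {y ∈ B | y ∉ K} K₀ := by
      rw [Finset.disjoint_left]
      intro y hy hy'
      exact (Finset.mem_filter.1 hy).2 (Finset.mem_insert_of_mem hy')
    have := hK₀ _ hd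
    rw [Finset.sum_filter, Real.norm_eq_abs] at this
    refine (le_abs_self _).trans (le_of_eq_of_le ?_ this.le)
    congr 1
    exact Finset.sum_congr rfl fun y _ => by by_cases hy : y ∈ K <;> simp [g, hy]
  have hexit : ∀ e, μ.real (exitEvent f S e) ≤ g e.1 + g (e.1 * f e.2) := by
    intro e
    by_cases hne : (exitEvent f (S : Set G) e).Nonempty
    · obtain ⟨ω, y, z, hj, hy, hz, -⟩ := hne
      have hyK : y ∉ K := fun hyK => hz (hKS hj hyK)
      have hle : μ.real (exitEvent f S e) ≤ g y := by
        simp only [g, hyK, if_false]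
        refine measureReal_mono ?_ (measure_ne_top _ _)
        rintro ω ⟨y', z', hj', hy', hz', hc⟩
        have : y' = y := by
          rcases hj with ⟨rfl, rfl⟩ | ⟨rfl, rfl⟩ <;> rcases hj' with ⟨rfl, rfl⟩ | ⟨rfl, rfl⟩ <;>
            first | rfl | exact absurd hy' hz
        exact this ▸ hc.mono (cut_le _ _)
      rcases hj with ⟨rfl, rfl⟩ | ⟨rfl, rfl⟩
      · linarith [hg0 (e.1 * f e.2)]
      · linarith [hg0 e.1]
    · rw [not_nonempty_iff_eq_empty.1 hne]
      simpa using add_nonneg (hg0 _) (hg0 _)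
  refine ⟨S, h1, ?_⟩
  have hbound : ∀ F : Finset (G × ι), ∑ e ∈ F, μ.real (exitEvent f S e) ≤
      2 * Fintype.card ι * ε := by
    intro F
    have hprod : ∀ u : G × ι → G, (∀ i, Function.Injective fun a => u (a, i)) →
        ∑ e ∈ F, g (u e) ≤ Fintype.card ι * ε := by
      intro u hu
      calc ∑ e ∈ F, g (u e) ≤ ∑ e ∈ F.image Prod.fst ×ˢ Finset.univ, g (u e) :=
            Finset.sum_le_sum_of_subset_of_nonneg (fun e he => Finset.mem_product.2
              ⟨Finset.mem_image_of_mem _ he, Finset.mem_univ _⟩) fun _ _ _ => hg0 _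
        _ = ∑ i : ι, ∑ y ∈ (F.image Prod.fst).image fun a => u (a, i), g y := by
            rw [Finset.sum_product_right]
            exact Finset.sum_congr rfl fun i _ => by rw [Finset.sum_image (hu i).injOn]
        _ ≤ ∑ i : ι, ε := Finset.sum_le_sum fun i _ => hgsum _
        _ = _ := by simp
    calc _ ≤ ∑ e ∈ F, (g e.1 + g (e.1 * f e.2)) := Finset.sum_le_sum fun e _ => hexit e
      _ ≤ _ := by
        rw [Finset.sum_add_distrib]
        linarith [hprod (fun e => e.1) fun i a b hab => hab,
          hprod (fun e => e.1 * f e.2) fun i a b hab => mul_right_cancel hab]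
  have hlt : 2 * Fintype.card ι * ε < 1 := by
    rw [hε, mul_one_div, div_lt_one (by positivity)]
    linarith
  calc exitSum f μ p S ≤ 1 * _ := mul_le_mul_of_nonneg_right hp.2
        (Finset.sum_nonneg fun _ _ => measureReal_nonneg)
    _ < 1 := by rw [one_mul]; exact (hbound _).trans_lt hlt

end Criterion

section Critical

variable {G ι : Type*} [Group G] {f : ι → G} {p : ℝ} {μ : ℝ → Measure (Config (G × ι))}

lemma innerEdges_subset_touchingEdges (S : Set G) : innerEdges f S ⊆ touchingEdges f S :=
  fun _ h => .inl h.1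

lemma isUpperSet_exitEvent (S : Set G) (e : G × ι) : IsUpperSet (exitEvent f S e) := by
  rintro ω ω' h ⟨y, z, hj, hy, hz, hc⟩
  exact ⟨y, z, hj, hy, hz, hc.mono (cut_le_cut le_rfl h)⟩

lemma theta_eq_zero_of_chi_ne_top {ν : Measure (Config (G × ι))} [Countable G] [Countable ι]
    (hχ : chi f ν ≠ ⊤) : theta f ν = 0 := by
  rw [chi_eq_tsum] at hχ
  have h := ae_finite_setOfPred_mem hχ
  rw [ae_iff] at h
  rw [theta, ← ENNReal.toReal_zero, ← h]
  rfl

lemma determined_exitEvent_touchingEdges [Finite ι] (S : Finset G) (e : G × ι) :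
    Determined (exitEvent f S e) ((finite_touchingEdges (f := f) S).toFinset : Set (G × ι)) := by
  rw [Set.Finite.coe_toFinset]
  exact (determined_exitEvent _ e).mono (innerEdges_subset_touchingEdges _)

lemma pc_nonneg : 0 ≤ pc f μ := by
  refine Real.sInf_nonneg ?_
  rintro q (hq | rfl)
  · exact hq.1.1
  · exact zero_le_one

lemma pc_le_one : pc f μ ≤ 1 :=
  csInf_le ⟨0, by rintro q (hq | rfl); exacts [hq.1.1, zero_le_one]⟩ (.inr rfl)

lemma pc_le (hp : p ∈ Icc (0 : ℝ) 1) (hθ : 0 < theta f (μ p)) : pc f μ ≤ p :=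
  csInf_le ⟨0, by rintro q (hq | rfl); exacts [hq.1.1, zero_le_one]⟩ (.inl ⟨hp, hθ⟩)

variable [Countable G] [Finite ι]

lemma monotoneOn_exitSum (hμ : ∀ p ∈ Icc (0 : ℝ) 1, IsBernoulli p (μ p)) (S : Finset G) :
    MonotoneOn (fun q => exitSum f (μ q) q S) (Icc 0 1) := by
  intro q hq q' hq' hqq'
  refine mul_le_mul hqq' (Finset.sum_le_sum fun e _ => ?_)
    (Finset.sum_nonneg fun _ _ => measureReal_nonneg) hq'.1
  exact monotoneOn_measureReal hμ (measurableSet_exitEvent _ _)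
    (determined_exitEvent_touchingEdges S e) (isUpperSet_exitEvent _ _) hq hq' hqq'

lemma continuousOn_exitSum (hμ : ∀ p ∈ Icc (0 : ℝ) 1, IsBernoulli p (μ p)) (S : Finset G) :
    ContinuousOn (fun q => exitSum f (μ q) q S) (Icc 0 1) := by
  refine continuousOn_id.mul (continuousOn_finsetSum _ fun e _ q hq => ?_)
  exact (hasDerivWithinAt_measureReal hμ _ (measurableSet_exitEvent _ _)
    (determined_exitEvent_touchingEdges S e) hq).continuousWithinAt

/-- Finiteness of the expected cluster size is an open condition. -/
lemma exists_gt_forall_chi_ne_top (hμ : ∀ p ∈ Icc (0 : ℝ) 1, IsBernoulli p (μ p))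
    (hp : p ∈ Ico (0 : ℝ) 1) (hχ : chi f (μ p) ≠ ⊤) :
    ∃ p' ∈ Ioo p 1, ∀ q ∈ Icc 0 p', chi f (μ q) ≠ ⊤ := by
  have hp' : p ∈ Icc (0 : ℝ) 1 := ⟨hp.1, hp.2.le⟩
  obtain ⟨S, hS, hlt⟩ := (hμ p hp').exists_exitSum_lt_one hp' hχ
  have hev := ((continuousOn_exitSum hμ S).mono (fun q hq => ⟨hp.1.trans hq.1, hq.2.le⟩ :
    Ico p 1 ⊆ Icc 0 1)) p ⟨le_rfl, hp.2⟩ |>.mono Ioo_subset_Ico_self |>.eventually (gt_mem_nhds hlt)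
  rw [nhdsWithin_Ioo_eq_nhdsGT hp.2] at hev
  obtain ⟨p', hlt', hp'1⟩ := (hev.and (Ioo_mem_nhdsGT hp.2)).exists
  refine ⟨p', hp'1, fun q hq => ?_⟩
  have hq1 : q ∈ Icc (0 : ℝ) 1 := ⟨hq.1, hq.2.trans hp'1.2.le⟩
  exact (hμ q hq1).chi_ne_top_of_exitSum_lt_one hq1 hS <|
    (monotoneOn_exitSum hμ S hq1 ⟨hq.1.trans hq.2, hp'1.2.le⟩ hq.2).trans_lt hlt'

lemma chi_eq_top_of_pc_le (hμ : ∀ p ∈ Icc (0 : ℝ) 1, IsBernoulli p (μ p))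
    (hp : pc f μ ≤ p) (hp1 : p < 1) : chi f (μ p) = ⊤ := by
  by_contra hχ
  obtain ⟨p', hp', h⟩ := exists_gt_forall_chi_ne_top hμ ⟨pc_nonneg.trans hp, hp1⟩ hχ
  refine (hp.trans_lt hp'.1).not_ge (le_csInf ⟨1, .inr rfl⟩ ?_)
  rintro q (⟨hq, hθ⟩ | rfl)
  · by_contra! hlt
    exact hθ.ne' (theta_eq_zero_of_chi_ne_top (h q ⟨hq.1, hlt.le⟩))
  · exact hp'.2.le

end Critical

section Sharpness

variable {G ι : Type*} [Group G] {f : ι → G} {p : ℝ} {μ : ℝ → Measure (Config (G × ι))}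

/-- The vertex `y` is connected to the complement of `Λ` by edges with an endpoint in `Λ`. -/
def Escapes (f : ι → G) (Λ : Set G) (ω : Config (G × ι)) (y : G) : Prop :=
  ∃ x ∉ Λ, Conn f (cut (touchingEdges f Λ) ω) y x

lemma Escapes.mono {Λ : Set G} {ω ω' : Config (G × ι)} {y : G} (h : Escapes f Λ ω y)
    (hω : ω ≤ ω') : Escapes f Λ ω' y := by
  obtain ⟨x, hx, hc⟩ := h
  exact ⟨x, hx, hc.mono (cut_le_cut le_rfl hω)⟩

lemma Escapes.of_notMem {Λ : Set G} {ω : Config (G × ι)} {y : G} (hy : y ∉ Λ) :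
    Escapes f Λ ω y :=
  ⟨y, hy, .refl⟩

lemma Escapes.of_step {Λ : Set G} {ω : Config (G × ι)} {y z : G} (hz : Escapes f Λ ω z)
    (h : Step f (cut (touchingEdges f Λ) ω) y z) : Escapes f Λ ω y := by
  obtain ⟨x, hx, hc⟩ := hz
  exact ⟨x, hx, Relation.ReflTransGen.head h hc⟩

lemma measurableSet_escapes [Countable G] [Countable ι] (Λ : Set G) (y : G) :
    MeasurableSet {ω | Escapes f Λ ω y} := by
  simp only [Escapes, ofPred_exists]
  exact .iUnion fun x => (MeasurableSet.const _).inter (measurableSet_conn_cut _ _ _)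

lemma determined_escapes (Λ : Set G) (y : G) :
    Determined {ω | Escapes f Λ ω y} (touchingEdges f Λ) :=
  determined_cut _ fun ω => ∃ x ∉ Λ, Conn f ω y x

/-- The set of vertices that do not escape from `Λ` is `S`. -/
def trappedEq (f : ι → G) (Λ S : Set G) : Set (Config (G × ι)) :=
  {ω | ∀ y, y ∈ S ↔ ¬ Escapes f Λ ω y}

lemma measurableSet_trappedEq [Countable G] [Countable ι] (Λ S : Set G) :
    MeasurableSet (trappedEq f Λ S) := by
  simp only [trappedEq, ofPred_forall]
  exact .iInter fun y => (MeasurableSet.const _).iff (measurableSet_escapes _ _).compl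

lemma trappedEq_of_eqOn {Λ S : Set G} {ω ω' : Config (G × ι)}
    (h : ∀ e ∈ (innerEdges f S)ᶜ, ω e = ω' e) (hω : ω ∈ trappedEq f Λ S) :
    ω' ∈ trappedEq f Λ S := by
  intro y
  rw [hω y, not_iff_not]
  constructor
  · rintro ⟨x, hx, hc⟩
    induction hc using Relation.ReflTransGen.head_induction_on with
    | refl => exact .of_notMem hx
    | @head a b hab hbx ih =>
      obtain ⟨e, heΛ, he, hj⟩ := step_cut_iff.1 hab
      have he' : e ∉ innerEdges f S := fun heS =>
        (hω b).1 ((hj.mem_innerEdges_iff _).1 heS).2 ⟨x, hx, hbx⟩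
      exact ih.of_step (step_cut_iff.2 ⟨e, heΛ, (h e he').symm.trans he, hj⟩)
  · rintro ⟨x, hx, hc⟩
    induction hc using Relation.ReflTransGen.head_induction_on with
    | refl => exact .of_notMem hx
    | @head a b hab _ ih =>
      obtain ⟨e, heΛ, he, hj⟩ := step_cut_iff.1 hab
      have he' : e ∉ innerEdges f S := fun heS =>
        (hω b).1 ((hj.mem_innerEdges_iff _).1 heS).2 ih
      exact ih.of_step (step_cut_iff.2 ⟨e, heΛ, (h e he').trans he, hj⟩)

lemma determined_trappedEq (Λ S : Set G) :
    Determined (trappedEq f Λ S) (innerEdges f S)ᶜ := fun _ _ h =>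
  propext ⟨trappedEq_of_eqOn fun e he => h e he, trappedEq_of_eqOn fun e he => (h e he).symm⟩

lemma trappedEq_subset {Λ S : Set G} {ω : Config (G × ι)} (hω : ω ∈ trappedEq f Λ S) : S ⊆ Λ :=
  fun y hy => by_contra fun hyΛ => (hω y).1 hy (.of_notMem hyΛ)

/-- If the set of vertices that do not escape from `Λ` is `S ∋ 1`, then the edges counted by
`exitEvent f S` are pivotal for the identity to escape. -/
lemma trappedEq_inter_exitEvent_subset {Λ S : Set G} (hS : 1 ∈ S) (e : G × ι) :
    trappedEq f Λ S ∩ exitEvent f S e ⊆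
      pin e true {ω | Escapes f Λ ω 1} \ pin e false {ω | Escapes f Λ ω 1} := by
  classical
  rintro ω ⟨hω, y, z, hj, hy, hz, hc⟩
  have hSΛ := trappedEq_subset hω
  have hle : ω ≤ Function.update ω e true := le_update_iff.2 ⟨Bool.le_true _, fun _ _ => le_rfl⟩
  have hge : Function.update ω e false ≤ ω := update_le_iff.2 ⟨Bool.false_le _, fun _ _ => le_rfl⟩
  refine ⟨?_, fun h => (hω 1).1 hS (Escapes.mono h (by convert hge))⟩
  have hzesc : Escapes f Λ ω z := not_not.1 fun h => hz ((hω z).2 h)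
  obtain ⟨x, hx, hzx⟩ := hzesc.mono hle
  have hyz : Step f (cut (touchingEdges f Λ) (Function.update ω e true)) y z :=
    step_cut_iff.2 ⟨e, (hj.mem_touchingEdges_iff _).2 (.inl (hSΛ hy)), by simp, hj⟩
  have h1y : Conn f (cut (touchingEdges f Λ) (Function.update ω e true)) 1 y :=
    hc.mono (cut_le_cut (fun e he => .inl (hSΛ he.1)) hle)
  have : Escapes f Λ (Function.update ω e true) 1 :=
    ⟨x, hx, Relation.ReflTransGen.trans h1y (Relation.ReflTransGen.head hyz hzx)⟩
  simp only [pin, mem_ofPred_eq]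
  convert this

variable [Countable G] [Finite ι]

lemma one_sub_le_sum_pin_escapes {ν : Measure (Config (G × ι))} (h : IsBernoulli p ν)
    (hp : p ∈ Icc (0 : ℝ) 1) (hexit : ∀ S : Finset G, 1 ∈ S → 1 ≤ exitSum f ν p S)
    (Λ : Finset G) :
    1 - ν.real {ω | Escapes f Λ ω 1} ≤ ∑ e ∈ (finite_touchingEdges (f := f) Λ).toFinset,
      (ν.real (pin e true {ω | Escapes f Λ ω 1}) - ν.real (pin e false {ω | Escapes f Λ ω 1})) := by
  classical
  have := h.isProbabilityMeasure
  have hA := measurableSet_escapes (f := f) (Λ : Set G) 1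
  have hup : IsUpperSet {ω | Escapes f Λ ω 1} := fun ω ω' hω h => Escapes.mono h hω
  let P : Finset (Finset G) := {S ∈ Λ.powerset | 1 ∈ S}
  have hdisj : ∀ B : Finset G → Set (Config (G × ι)),
      (P : Set (Finset G)).PairwiseDisjoint fun S => trappedEq f (Λ : Set G) S ∩ B S := by
    intro B S _ S' _ hne
    refine Set.disjoint_left.2 fun ω hω hω' => hne ?_
    ext y
    exact (hω.1 y).trans (hω'.1 y).symm
  have hcompl : 1 - ν.real {ω | Escapes f Λ ω 1} ≤
      ∑ S ∈ P, ν.real (trappedEq f (Λ : Set G) S) := by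
    rw [← probReal_compl_eq_one_sub hA]
    refine (measureReal_mono ?_ (measure_ne_top _ _)).trans (measureReal_biUnion_finset_le P _)
    intro ω hω
    simp only [mem_iUnion]
    refine ⟨({y ∈ Λ | ¬ Escapes f Λ ω y}), ?_, ?_⟩
    · have h1 : (1 : G) ∈ Λ := by_contra fun h1 => hω (.of_notMem h1)
      simpa [P, h1] using hω
    · intro y
      simp only [Finset.coe_filter, mem_ofPred_eq, and_iff_right_iff_imp]
      exact fun hy => by_contra fun hyΛ => hy (.of_notMem hyΛ)
  refine hcompl.trans ?_
  calc ∑ S ∈ P, ν.real (trappedEq f (Λ : Set G) S)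
      ≤ ∑ S ∈ P, ∑ e ∈ (finite_touchingEdges (f := f) Λ).toFinset,
        ν.real (trappedEq f (Λ : Set G) S ∩ exitEvent f S e) := by
        refine Finset.sum_le_sum fun S hS => ?_
        simp only [P, Finset.mem_filter, Finset.mem_powerset] at hS
        have hind : ∀ e, ν.real (trappedEq f (Λ : Set G) S ∩ exitEvent f S e) =
            ν.real (trappedEq f (Λ : Set G) S) * ν.real (exitEvent f S e) := fun e => by
          simp only [Measure.real]
          rw [h.measure_inter hp (determined_trappedEq _ _) (determined_exitEvent _ _)
            (measurableSet_trappedEq _ _) (measurableSet_exitEvent _ _) disjoint_compl_left,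
            ENNReal.toReal_mul]
        simp only [hind]
        rw [← Finset.mul_sum]
        refine le_mul_of_one_le_right measureReal_nonneg ?_
        have h0 : 0 ≤ ∑ e ∈ (finite_touchingEdges (f := f) S).toFinset,
          ν.real (exitEvent f S e) := Finset.sum_nonneg fun _ _ => measureReal_nonneg
        refine ((hexit S hS.2).trans (mul_le_of_le_one_left h0 hp.2)).trans ?_
        refine Finset.sum_le_sum_of_subset_of_nonneg ?_ fun _ _ _ => measureReal_nonneg
        exact Set.Finite.toFinset_subset_toFinset.2 fun e he =>
          he.imp (fun h => hS.1 h) fun h => hS.1 h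
    _ ≤ _ := by
        rw [Finset.sum_comm]
        refine Finset.sum_le_sum fun e _ => ?_
        rw [← measureReal_sdiff (pin_false_subset_pin_true hup e) (measurableSet_pin hA e false),
          ← measureReal_biUnion_finset (hdisj fun S => exitEvent f S e) fun S _ =>
            (measurableSet_trappedEq _ _).inter (measurableSet_exitEvent _ _)]
        refine measureReal_mono (iUnion₂_subset fun S hS => ?_) (measure_ne_top _ _)
        exact trappedEq_inter_exitEvent_subset (Finset.mem_filter.1 hS).2 e

lemma one_sub_exp_le_measureReal_escapes (hμ : ∀ p ∈ Icc (0 : ℝ) 1, IsBernoulli p (μ p))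
    (hp : p ∈ Icc (0 : ℝ) 1) (hχ : chi f (μ p) = ⊤) {q : ℝ} (hq : q ∈ Icc p 1) (Λ : Finset G) :
    1 - Real.exp (p - q) ≤ (μ q).real {ω | Escapes f Λ ω 1} := by
  set F := (finite_touchingEdges (f := f) Λ).toFinset
  set A := {ω | Escapes f Λ ω 1}
  have hA : MeasurableSet A := measurableSet_escapes (f := f) (Λ : Set G) 1
  have hF : Determined A (F : Set (G × ι)) := by
    rw [Set.Finite.coe_toFinset]
    exact determined_escapes _ _
  have hsub : Icc p 1 ⊆ Icc (0 : ℝ) 1 := Icc_subset_Icc_left hp.1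
  have hder : ∀ r ∈ Icc p 1, HasDerivWithinAt (fun r => (1 - (μ r).real A) * Real.exp r)
      (-(∑ e ∈ F, ((μ r).real (pin e true A) - (μ r).real (pin e false A))) * Real.exp r +
        (1 - (μ r).real A) * Real.exp r) (Icc p 1) r := fun r hr =>
    (((hasDerivWithinAt_measureReal hμ F hA hF (hsub hr)).mono hsub).const_sub 1).mul
      (Real.hasDerivAt_exp r).hasDerivWithinAt
  have hanti : AntitoneOn (fun r => (1 - (μ r).real A) * Real.exp r) (Icc p 1) := by
    refine antitoneOn_of_hasDerivWithinAt_nonpos (convex_Icc p 1)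
      (fun r hr => (hder r hr).continuousWithinAt)
      (fun r hr => (hder r (interior_subset hr)).mono interior_subset) fun r hr => ?_
    have hr' := interior_subset hr
    rw [← add_mul]
    refine mul_nonpos_of_nonpos_of_nonneg ?_ (Real.exp_pos r).le
    have hexit : ∀ S : Finset G, 1 ∈ S → 1 ≤ exitSum f (μ r) r S := by
      intro S hS
      by_contra! hlt
      exact (hμ p hp).chi_ne_top_of_exitSum_lt_one hp hS
        ((monotoneOn_exitSum hμ S hp (hsub hr') hr'.1).trans_lt hlt) hχ
    linarith [one_sub_le_sum_pin_escapes (hμ r (hsub hr')) (hsub hr') hexit Λ]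
  have h := hanti ⟨le_rfl, hp.2⟩ hq hq.1
  have h1 : (1 - (μ p).real A) * Real.exp p ≤ Real.exp p :=
    mul_le_of_le_one_left (Real.exp_pos p).le (by linarith [measureReal_nonneg (μ := μ p) (s := A)])
  have h2 : 1 - (μ q).real A ≤ Real.exp (p - q) := by
    rw [Real.exp_sub, le_div_iff₀ (Real.exp_pos q)]
    exact h.trans h1
  linarith

/-- **Sharpness of the phase transition**. -/
theorem theta_pos_of_chi_eq_top (hμ : ∀ p ∈ Icc (0 : ℝ) 1, IsBernoulli p (μ p))
    (hp : p ∈ Icc (0 : ℝ) 1) (hχ : chi f (μ p) = ⊤) {q : ℝ} (hq : q ∈ Ioc p 1) :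
    0 < theta f (μ q) := by
  have := (hμ q ⟨hp.1.trans hq.1.le, hq.2⟩).isProbabilityMeasure
  let E (Λ : Finset G) : Set (Config (G × ι)) := {ω | ∃ x ∉ Λ, Conn f ω 1 x}
  have hE : ∀ Λ, MeasurableSet (E Λ) := fun Λ => by
    simp only [E, ofPred_exists]
    exact .iUnion fun x => (MeasurableSet.const _).inter (measurableSet_conn _ _)
  have hinf : {ω | (cluster f ω).Infinite} = ⋂ Λ, E Λ := by
    ext ω
    simp only [mem_iInter]
    refine ⟨fun h Λ => ?_, fun h hfin => ?_⟩
    · obtain ⟨x, hx, hxΛ⟩ := h.exists_notMem_finset Λ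
      exact ⟨x, hxΛ, hx⟩
    · obtain ⟨x, hx, hc⟩ := h hfin.toFinset
      exact hx (hfin.mem_toFinset.2 hc)
  have hdir : Directed (· ⊇ ·) E := by
    classical
    refine fun Λ Λ' => ⟨Λ ∪ Λ', ?_, ?_⟩ <;> rintro ω ⟨x, hx, hc⟩ <;>
      rw [Finset.notMem_union] at hx
    exacts [⟨x, hx.1, hc⟩, ⟨x, hx.2, hc⟩]
  have hlt : Real.exp (p - q) < 1 := Real.exp_lt_one_iff.2 (by linarith [hq.1])
  have hle : ENNReal.ofReal (1 - Real.exp (p - q)) ≤ μ q {ω | (cluster f ω).Infinite} := by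
    rw [hinf, hdir.measure_iInter (fun Λ => (hE Λ).nullMeasurableSet) ⟨∅, measure_ne_top _ _⟩]
    refine le_iInf fun Λ => ?_
    rw [← ofReal_measureReal (measure_ne_top _ _)]
    refine ENNReal.ofReal_le_ofReal <|
      (one_sub_exp_le_measureReal_escapes hμ hp hχ ⟨hq.1.le, hq.2⟩ Λ).trans <|
        measureReal_mono ?_ (measure_ne_top _ _)
    rintro ω ⟨x, hx, hc⟩
    exact ⟨x, hx, hc.mono (cut_le _ _)⟩
  exact ENNReal.toReal_pos ((ENNReal.ofReal_pos.2 (by linarith)).trans_le hle).ne'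
    (measure_ne_top _ _)

lemma chi_ne_top_of_lt_pc (hμ : ∀ p ∈ Icc (0 : ℝ) 1, IsBernoulli p (μ p))
    (hp : 0 ≤ p) (hpc : p < pc f μ) : chi f (μ p) ≠ ⊤ := by
  intro hχ
  obtain ⟨q, hpq, hq⟩ := exists_between hpc
  have hq1 : q ≤ 1 := hq.le.trans pc_le_one
  exact hq.not_ge <| pc_le ⟨hp.trans hpq.le, hq1⟩ <|
    theta_pos_of_chi_eq_top hμ ⟨hp, hpq.le.trans hq1⟩ hχ ⟨hpq, hq1⟩

end Sharpness

section FreeProduct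

open Monoid CoprodI

section Words

variable {κ : Type*} {G : κ → Type*} [∀ i, Group (G i)] {i j : κ}

/-- The elements of the free product whose reduced word does not start with a letter in `G i`. -/
def avoids (G : κ → Type*) [∀ i, Group (G i)] (i : κ) : Set (CoprodI G) :=
  {x | ∃ w : Word G, w.prod = x ∧ w.fstIdx ≠ some i}

lemma one_mem_avoids : (1 : CoprodI G) ∈ avoids G i :=
  ⟨Word.empty, rfl, by simp [Word.fstIdx]⟩

lemma exists_word_prod_eq (x : CoprodI G) : ∃ w : Word G, w.prod = x := by
  classical exact ⟨Word.equiv x, Word.equiv.symm_apply_apply x⟩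

lemma word_prod_injective : Function.Injective (Word.prod : Word G → CoprodI G) := by
  classical exact Word.equiv.symm.injective

lemma bijective_of_mul_avoids (i : κ) :
    Function.Bijective fun p : G i × avoids G i => of p.1 * (p.2 : CoprodI G) := by
  classical
  constructor
  · rintro ⟨g, _, w, rfl, hw⟩ ⟨g', _, w', rfl, hw'⟩ h
    have := Word.rcons_inj (a₁ := ⟨g, w, hw⟩) (a₂ := ⟨g', w', hw'⟩) <|
      word_prod_injective (by simpa using h)
    obtain ⟨rfl, rfl⟩ := Word.Pair.mk.inj this
    rfl
  · intro x
    obtain ⟨w, rfl⟩ := exists_word_prod_eq x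
    refine ⟨⟨(Word.equivPair i w).head, _, _, rfl, (Word.equivPair i w).fstIdx_ne⟩, ?_⟩
    simp only
    rw [← Word.prod_rcons, ← Word.equivPair_symm, Equiv.symm_apply_apply]

lemma exists_word_of (s : G j) :
    ∃ w : Word G, w.prod = of s ∧ (w = .empty ∨ w.fstIdx = some j) := by
  by_cases hs : s = 1
  · exact ⟨.empty, by simp [hs], .inl rfl⟩
  · exact ⟨.cons s .empty (by simp [Word.fstIdx]) hs, by simp, .inr (by simp)⟩

lemma exists_word_mul_of (w : Word G) (hw : w ≠ .empty) (s : G j) :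
    ∃ w' : Word G, w'.prod = w.prod * of s ∧ (w' = .empty ∨ w'.fstIdx = w.fstIdx) := by
  induction w using Word.consRecOn with
  | empty => exact absurd rfl hw
  | cons k m w h1 h2 ih =>
    by_cases hw : w = .empty
    · subst hw
      by_cases hkj : k = j
      · subst hkj
        obtain ⟨w', h, h'⟩ := exists_word_of (m * s)
        exact ⟨w', by simp [h], by simpa using h'⟩
      · obtain ⟨w', h, h'⟩ := exists_word_of s
        have hk : w'.fstIdx ≠ some k := by
          rcases h' with rfl | h'
          · simp [Word.fstIdx]
          · simpa [h'] using Ne.symm hkj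
        exact ⟨.cons m w' hk h2, by simp [h], by simp⟩
    · obtain ⟨w', h, h'⟩ := ih hw
      have hk : w'.fstIdx ≠ some k := by
        rcases h' with rfl | h'
        · simp [Word.fstIdx]
        · rwa [h']
      exact ⟨.cons m w' hk h2, by simp [h, mul_assoc], by simp⟩

lemma mul_of_mem_avoids {r : CoprodI G} (hr : r ∈ avoids G i) (s : G j) (h : ¬ (r = 1 ∧ j = i)) :
    r * of s ∈ avoids G i := by
  obtain ⟨w, rfl, hw⟩ := hr
  by_cases hw0 : w = .empty
  · subst hw0
    obtain ⟨w', h1, h2⟩ := exists_word_of s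
    refine ⟨w', by simp [h1], ?_⟩
    rcases h2 with rfl | h2
    · simp [Word.fstIdx]
    · simpa [h2] using fun hji => h ⟨rfl, hji⟩
  · obtain ⟨w', h1, h2⟩ := exists_word_mul_of w hw0 s
    refine ⟨w', h1, ?_⟩
    rcases h2 with rfl | h2
    · simp [Word.fstIdx]
    · rwa [h2]

lemma eq_of_of_mul_eq {g g' : G i} {r r' : CoprodI G} (hr : r ∈ avoids G i) (hr' : r' ∈ avoids G i)
    (h : of g * r = of g' * r') : g = g' ∧ r = r' := by
  have := (bijective_of_mul_avoids i).1 (a₁ := (g, ⟨r, hr⟩)) (a₂ := (g', ⟨r', hr'⟩)) h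
  simpa using this

/-- A nontrivial element starts with a letter in exactly one of the factors. -/
lemma existsUnique_notMem_avoids {x : CoprodI G} (hx : x ≠ 1) : ∃! i, x ∉ avoids G i := by
  obtain ⟨w, rfl⟩ := exists_word_prod_eq x
  have h : ∀ i, w.prod ∉ avoids G i ↔ w.fstIdx = some i := by
    intro i
    rw [not_iff_comm]
    refine ⟨fun h => ⟨w, rfl, h⟩, ?_⟩
    rintro ⟨w', hw', h⟩
    rwa [← word_prod_injective hw']
  simp only [h]
  rcases hi : w.fstIdx with _ | i
  · have : w = .empty := Word.ext (by simpa [Word.fstIdx] using hi)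
    simp [this] at hx
  · exact ⟨i, rfl, fun j hj => (Option.some.inj hj).symm⟩

end Words

variable {n : ℕ} {G : Fin n → Type*} [∀ i, Group (G i)] {S : ∀ i, Set (G i)}
  {ω : Config (CoprodI G × Σ i, S i)} {i : Fin n}

/-- The edges of the copy of the Cayley graph of `G i` through the identity. -/
def factorEdges (S : ∀ i, Set (G i)) (i : Fin n) : Set (CoprodI G × Σ i, S i) :=
  {e | (∃ g : G i, e.1 = of g) ∧ e.2.1 = i}

/-- The embedding of the edges of the Cayley graph of `G i` into those of the free product. -/
def factorEdge (S : ∀ i, Set (G i)) (i : Fin n) (e : G i × S i) : CoprodI G × Σ i, S i :=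
  (of e.1, ⟨i, e.2⟩)

lemma factorEdge_injective : Function.Injective (factorEdge S i) := by
  rintro ⟨a, s⟩ ⟨b, t⟩ h
  simp only [factorEdge, Prod.mk.injEq, Sigma.mk.injEq, heq_eq_eq, true_and] at h
  rw [of_injective i h.1, h.2]

lemma Joins.exists_eq_mul_of {e : CoprodI G × Σ i, S i} {x y : CoprodI G}
    (h : Joins (coprodIGens S) e x y) : ∃ s : G e.2.1, y = x * of s := by
  obtain ⟨rfl, rfl⟩ | ⟨rfl, rfl⟩ := h
  · exact ⟨_, rfl⟩
  · exact ⟨(e.2.2 : G e.2.1)⁻¹, by simp [coprodIGens]⟩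

lemma Joins.mem_factorEdges_iff {e : CoprodI G × Σ i, S i} {x y : CoprodI G}
    (h : Joins (coprodIGens S) e x y) :
    e ∈ factorEdges S i ↔ (∃ g : G i, x = of g) ∧ e.2.1 = i := by
  obtain ⟨rfl, rfl⟩ | ⟨rfl, rfl⟩ := h
  · rfl
  · refine and_congr_left ?_
    rcases e with ⟨x, j, s⟩
    rintro rfl
    constructor
    · rintro ⟨g, hg⟩
      simp only at hg
      exact ⟨g * s, by simp [coprodIGens, hg]⟩
    · rintro ⟨g, hg⟩
      exact ⟨g * (s : G j)⁻¹, by simp [coprodIGens, ← hg]⟩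

lemma Conn.exists_avoids {h₀ : G i} {x : CoprodI G} (h : Conn (coprodIGens S) ω (of h₀) x) :
    ∃ (g : G i), ∃ r ∈ avoids G i, x = of g * r ∧
      Conn (coprodIGens S) (cut (factorEdges S i) ω) (of h₀) (of g) ∧
      Conn (coprodIGens S) (cut (factorEdges S i)ᶜ ω) (of g) x := by
  induction h with
  | refl => exact ⟨h₀, 1, one_mem_avoids, by simp, .refl, .refl⟩
  | tail _ hbc ih =>
    obtain ⟨g, r, hr, rfl, hg, hx⟩ := ih
    obtain ⟨e, he, hj⟩ := step_iff.1 hbc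
    by_cases hri : r = 1 ∧ e.2.1 = i
    · obtain ⟨rfl, hi⟩ := hri
      have heT := (hj.mem_factorEdges_iff (i := i)).2 ⟨⟨g, mul_one _⟩, hi⟩
      obtain ⟨s, hs⟩ := hj.exists_eq_mul_of
      obtain ⟨s', hs'⟩ : ∃ s' : G i, of s' = of s := by
        subst hi; exact ⟨s, rfl⟩
      rw [mul_one, ← hs', ← map_mul] at hs
      subst hs
      rw [mul_one] at hj
      exact ⟨g * s', 1, one_mem_avoids, by simp,
        Relation.ReflTransGen.tail hg (step_cut_iff.2 ⟨e, heT, he, hj⟩), .refl⟩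
    · obtain ⟨s, rfl⟩ := hj.exists_eq_mul_of
      refine ⟨g, r * of s, mul_of_mem_avoids hr s hri, by rw [mul_assoc], hg,
        Relation.ReflTransGen.tail hx (step_cut_iff.2 ⟨e, fun heT => hri ?_, he, hj⟩)⟩
      obtain ⟨⟨g', hg'⟩, hi⟩ := hj.mem_factorEdges_iff.1 heT
      exact ⟨(eq_of_of_mul_eq hr one_mem_avoids (hg'.trans (mul_one _).symm)).2, hi⟩

lemma conn_of_mul_iff {h₀ g : G i} {r : CoprodI G} (hr : r ∈ avoids G i) :
    Conn (coprodIGens S) ω (of h₀) (of g * r) ↔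
      Conn (coprodIGens S) (cut (factorEdges S i) ω) (of h₀) (of g) ∧
      Conn (coprodIGens S) (cut (factorEdges S i)ᶜ ω) (of g) (of g * r) := by
  constructor
  · intro h
    obtain ⟨g', r', hr', heq, h1, h2⟩ := h.exists_avoids
    obtain ⟨rfl, rfl⟩ := eq_of_of_mul_eq hr hr' heq
    exact ⟨h1, h2⟩
  · rintro ⟨h1, h2⟩
    exact Relation.ReflTransGen.trans (h1.mono (cut_le _ _)) (h2.mono (cut_le _ _))

lemma conn_cut_factorEdges_iff {g h : G i} :
    Conn (coprodIGens S) (cut (factorEdges S i) ω) (of g) (of h) ↔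
      Conn (setGens (S i)) (ω ∘ factorEdge S i) g h := by
  constructor
  · suffices H : ∀ y, Conn (coprodIGens S) (cut (factorEdges S i) ω) (of g) y →
        ∃ b, y = of b ∧ Conn (setGens (S i)) (ω ∘ factorEdge S i) g b by
      intro hc
      obtain ⟨b, hb, hgb⟩ := H _ hc
      rwa [of_injective i hb]
    intro y hy
    induction hy with
    | refl => exact ⟨g, rfl, .refl⟩
    | tail _ hbc ih =>
      obtain ⟨b, rfl, hgb⟩ := ih
      obtain ⟨⟨a, j, s⟩, ⟨⟨g', hg'⟩, hj⟩, he, hjoin⟩ := step_cut_iff.1 hbc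
      simp only at hg' hj
      subst hj hg'
      rcases hjoin with ⟨h1, rfl⟩ | ⟨rfl, h1⟩
      · have := of_injective _ h1
        subst this
        exact ⟨b * s, (map_mul _ _ _).symm,
          Relation.ReflTransGen.tail hgb ⟨s, .inl ⟨he, rfl⟩⟩⟩
      · have : b = g' * s := of_injective _ (h1.trans (map_mul _ _ _).symm)
        exact ⟨g', rfl, Relation.ReflTransGen.tail hgb ⟨s, .inr ⟨he, this⟩⟩⟩
  · intro hc
    refine Relation.ReflTransGen.lift (fun a : G i => (of a : CoprodI G)) (fun a b hab => ?_) _ _ hc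
    obtain ⟨e, he, hj⟩ := step_iff.1 hab
    refine step_cut_iff.2 ⟨factorEdge S i e, ⟨⟨e.1, rfl⟩, rfl⟩, he, ?_⟩
    rcases hj with ⟨rfl, rfl⟩ | ⟨rfl, rfl⟩
    · exact .inl ⟨rfl, map_mul _ _ _⟩
    · exact .inr ⟨rfl, map_mul _ _ _⟩

lemma countable_coprodI [∀ i, Countable (G i)] : Countable (CoprodI G) := by
  have : Countable (Word G) :=
    Function.Injective.countable (f := Word.toList) fun _ _ h => Word.ext h
  exact Function.Surjective.countable (f := Word.prod) exists_word_prod_eq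

lemma countable_of_closure_eq_top {H : Type*} [Group H] {T : Set H} (hT : T.Finite)
    (h : Subgroup.closure T = ⊤) : Countable H := by
  have := hT.countable.to_subtype
  have : Countable (FreeGroup T) := Quot.mk_surjective.countable
  refine Function.Surjective.countable (f := FreeGroup.lift ((↑) : T → H)) ?_
  rw [← MonoidHom.range_eq_top, FreeGroup.range_lift_eq_closure, Subtype.range_coe, h]

variable {p : ℝ} {μ : Measure (Config (CoprodI G × Σ i, S i))}

/-- The expected number of vertices in the cluster of the identity of the free product whose
reduced word does not start with a letter in `G i`. -/
noncomputable def chiAvoids (μ : Measure (Config (CoprodI G × Σ i, S i))) (i : Fin n) : ℝ≥0∞ :=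
  ∑' r : avoids G i, μ {ω | Conn (coprodIGens S) ω 1 r}

lemma one_le_chiAvoids (hμ : IsBernoulli p μ) : 1 ≤ chiAvoids μ i := by
  have := hμ.isProbabilityMeasure
  have h : {ω : Config (CoprodI G × Σ i, S i) | Conn (coprodIGens S) ω 1 1} = univ :=
    eq_univ_of_forall fun ω => Relation.ReflTransGen.refl
  refine le_trans ?_ (ENNReal.le_tsum ⟨1, one_mem_avoids⟩)
  simp [h]

variable [∀ i, Countable (G i)] {μi : ∀ i, Measure (Config (G i × S i))}

lemma measure_conn_of (hμ : IsBernoulli p μ) (hμi : IsBernoulli p (μi i)) (g : G i) :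
    μ {ω | Conn (coprodIGens S) ω 1 (of g)} = μi i {ω | Conn (setGens (S i)) ω 1 g} := by
  rw [← (hμ.map_comp factorEdge_injective).eq hμi,
    Measure.map_apply (by fun_prop) (measurableSet_conn _ _)]
  congr 1
  ext ω
  have h := conn_of_mul_iff (S := S) (ω := ω) (h₀ := (1 : G i)) (g := g) one_mem_avoids
  rw [mul_one, map_one] at h
  simp only [mem_ofPred_eq, mem_preimage, h, ← conn_cut_factorEdges_iff, map_one]
  exact and_iff_left .refl

lemma measure_conn_of_mul (hp : p ∈ Icc (0 : ℝ) 1) (hμ : IsBernoulli p μ)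
    (hμi : IsBernoulli p (μi i)) (g : G i) {r : CoprodI G} (hr : r ∈ avoids G i) :
    μ {ω | Conn (coprodIGens S) ω 1 (of g * r)} =
      μi i {ω | Conn (setGens (S i)) ω 1 g} * μ {ω | Conn (coprodIGens S) ω 1 r} := by
  have := countable_coprodI (G := G)
  have h1 : {ω | Conn (coprodIGens S) ω 1 (of g * r)} =
      {ω | Conn (coprodIGens S) (cut (factorEdges S i) ω) 1 (of g)} ∩
      {ω | Conn (coprodIGens S) (cut (factorEdges S i)ᶜ ω) (of g) (of g * r)} := by
    ext ω
    simpa using conn_of_mul_iff (S := S) (ω := ω) (h₀ := (1 : G i)) (g := g) hr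
  have h2 : {ω | Conn (coprodIGens S) (cut (factorEdges S i) ω) 1 (of g)} =
      {ω | Conn (coprodIGens S) ω 1 (of g)} := by
    ext ω
    have h := conn_of_mul_iff (S := S) (ω := ω) (h₀ := (1 : G i)) (g := g) one_mem_avoids
    rw [mul_one, map_one] at h
    exact ⟨fun hc => h.2 ⟨hc, .refl⟩, fun hc => (h.1 hc).1⟩
  have h3 : {ω | Conn (coprodIGens S) (cut (factorEdges S i)ᶜ ω) (of g) (of g * r)} =
      {ω | Conn (coprodIGens S) ω (of g * 1) (of g * r)} := by
    ext ω
    have h := conn_of_mul_iff (S := S) (ω := ω) (h₀ := g) (g := g) hr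
    rw [mul_one]
    exact ⟨fun hc => h.2 ⟨.refl, hc⟩, fun hc => (h.1 hc).2⟩
  rw [h1, hμ.measure_inter hp (determined_cut _ fun ω => Conn (coprodIGens S) ω 1 (of g))
    (determined_cut _ fun ω => Conn (coprodIGens S) ω (of g) (of g * r))
    (measurableSet_conn_cut _ _ _) (measurableSet_conn_cut _ _ _) disjoint_compl_right, h2, h3,
    hμ.measure_conn_mul, measure_conn_of hμ hμi]

lemma chi_eq_mul_chiAvoids (hp : p ∈ Icc (0 : ℝ) 1) (hμ : IsBernoulli p μ)
    (hμi : IsBernoulli p (μi i)) :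
    chi (coprodIGens S) μ = chi (setGens (S i)) (μi i) * chiAvoids μ i := by
  have := countable_coprodI (G := G)
  rw [chi_eq_tsum, chi_eq_tsum, ← (Equiv.ofBijective _ (bijective_of_mul_avoids i)).tsum_eq,
    ENNReal.tsum_prod', ← ENNReal.tsum_mul_right]
  refine tsum_congr fun g => ?_
  rw [chiAvoids, ← ENNReal.tsum_mul_left]
  exact tsum_congr fun r => measure_conn_of_mul hp hμ hμi g r.2

lemma sum_chiAvoids (hμ : IsBernoulli p μ) :
    ∑ i, chiAvoids μ i + chi (coprodIGens S) μ = n * chi (coprodIGens S) μ + 1 := by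
  classical
  have := countable_coprodI (G := G)
  have := hμ.isProbabilityMeasure
  set τ : CoprodI G → ℝ≥0∞ := fun x => μ {ω | Conn (coprodIGens S) ω 1 x} with hτ
  have hτ1 : τ 1 = 1 := by
    have : {ω : Config (CoprodI G × Σ i, S i) | Conn (coprodIGens S) ω 1 1} = univ :=
      eq_univ_of_forall fun ω => Relation.ReflTransGen.refl
    simp [hτ, this]
  have hχ : chi (coprodIGens S) μ = ∑' x, τ x := chi_eq_tsum
  have hV : ∀ i, chiAvoids μ i = ∑' x, (avoids G i).indicator τ x := fun i =>
    tsum_subtype (avoids G i) τ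
  have hone : (1 : ℝ≥0∞) = ∑' x : CoprodI G, if x = 1 then 1 else 0 := by simp
  rw [hχ, hone]
  simp only [hV]
  rw [← Summable.tsum_finsetSum fun _ _ => ENNReal.summable, ← ENNReal.tsum_add,
    ← ENNReal.tsum_mul_left, ← ENNReal.tsum_add]
  refine tsum_congr fun x => ?_
  by_cases hx : x = 1
  · subst hx
    simp [hτ1, one_mem_avoids]
  · obtain ⟨j, hj, huniq⟩ := existsUnique_notMem_avoids hx
    have hi : ∀ i ∈ Finset.univ.erase j, (avoids G i).indicator τ x = τ x := by
      intro i hi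
      refine Set.indicator_of_mem (by_contra fun h => (Finset.mem_erase.1 hi).1 (huniq i h)) _
    rw [← Finset.add_sum_erase _ _ (Finset.mem_univ j), Finset.sum_congr rfl hi,
      Set.indicator_of_notMem hj, if_neg hx]
    have hn : n = n - 1 + 1 := by have := j.pos; omega
    rw [Finset.sum_const, Finset.card_erase_of_mem (Finset.mem_univ j), Finset.card_univ,
      Fintype.card_fin, zero_add, add_zero, nsmul_eq_mul]
    conv_rhs => rw [hn]
    push_cast
    ring

lemma one_le_chi {H κ : Type*} [Group H] [Countable H] [Countable κ] {f : κ → H}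
    {ν : Measure (Config (H × κ))} (hν : IsBernoulli p ν) : 1 ≤ chi f ν := by
  have := hν.isProbabilityMeasure
  have h : {ω : Config (H × κ) | Conn f ω 1 1} = univ :=
    eq_univ_of_forall fun ω => Relation.ReflTransGen.refl
  rw [chi_eq_tsum]
  refine le_trans ?_ (ENNReal.le_tsum 1)
  simp [h]

lemma two_le_chi {H κ : Type*} [Group H] [Countable H] [Countable κ] {f : κ → H}
    {ν : Measure (Config (H × κ))} (hν : IsBernoulli 1 ν) {k : κ} (hk : f k ≠ 1) : 2 ≤ chi f ν := by
  classical
  have := hν.isProbabilityMeasure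
  have h : {ω : Config (H × κ) | Conn f ω 1 1} = univ :=
    eq_univ_of_forall fun ω => Relation.ReflTransGen.refl
  have hk1 : 1 ≤ ν {ω | Conn f ω 1 (f k)} := by
    rw [← ENNReal.ofReal_one, ← hν.measure_open (1, k)]
    exact measure_mono fun ω hω =>
      Relation.ReflTransGen.single ⟨k, .inl ⟨hω, (one_mul _).symm⟩⟩
  rw [chi_eq_tsum]
  calc (2 : ℝ≥0∞) = 1 + 1 := one_add_one_eq_two.symm
    _ ≤ ∑ x ∈ {1, f k}, ν {ω | Conn f ω 1 x} := by
      rw [Finset.sum_pair hk.symm, h, measure_univ]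
      gcongr
    _ ≤ _ := ENNReal.sum_le_tsum _

lemma chi_factor_ne_top (hp : p ∈ Icc (0 : ℝ) 1) (hμ : IsBernoulli p μ)
    (hμi : IsBernoulli p (μi i)) (hχ : chi (coprodIGens S) μ ≠ ⊤) :
    chi (setGens (S i)) (μi i) ≠ ⊤ := by
  rw [chi_eq_mul_chiAvoids hp hμ hμi] at hχ
  exact fun h => hχ (by rw [h, ENNReal.top_mul (one_pos.trans_le (one_le_chiAvoids hμ)).ne'])

lemma toReal_chi_eq_mul (hp : p ∈ Icc (0 : ℝ) 1) (hμ : IsBernoulli p μ)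
    (hμi : IsBernoulli p (μi i)) :
    (chi (coprodIGens S) μ).toReal =
      (chi (setGens (S i)) (μi i)).toReal * (chiAvoids μ i).toReal := by
  rw [chi_eq_mul_chiAvoids hp hμ hμi, ENNReal.toReal_mul]

lemma toReal_sum_chiAvoids (hμ : IsBernoulli p μ) (hχ : chi (coprodIGens S) μ ≠ ⊤) :
    ∑ i, (chiAvoids μ i).toReal + (chi (coprodIGens S) μ).toReal =
      n * (chi (coprodIGens S) μ).toReal + 1 := by
  have h := sum_chiAvoids hμ
  have hfin : (n : ℝ≥0∞) * chi (coprodIGens S) μ + 1 ≠ ⊤ :=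
    ENNReal.add_ne_top.2 ⟨ENNReal.mul_ne_top (ENNReal.natCast_ne_top n) hχ, ENNReal.one_ne_top⟩
  have hV : ∑ i, chiAvoids μ i ≠ ⊤ := (ENNReal.add_ne_top.1 (h ▸ hfin)).1
  have h' := congrArg ENNReal.toReal h
  rwa [ENNReal.toReal_add hV hχ,
    ENNReal.toReal_sum fun i _ => ENNReal.sum_ne_top.1 hV i (Finset.mem_univ i),
    ENNReal.toReal_add (ENNReal.mul_ne_top (ENNReal.natCast_ne_top n) hχ) ENNReal.one_ne_top,
    ENNReal.toReal_mul, ENNReal.toReal_natCast, ENNReal.toReal_one] at h'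

theorem chi_coprodIGens_eq (hp : p ∈ Icc (0 : ℝ) 1) (hμ : IsBernoulli p μ)
    (hμi : ∀ i, IsBernoulli p (μi i)) (hχ : chi (coprodIGens S) μ ≠ ⊤) :
    let c := fun i => (chi (setGens (S i)) (μi i)).toReal
    let D := ∑ j, ∏ i ∈ Finset.univ.erase j, c i - ((n : ℝ) - 1) * ∏ i, c i
    0 < D ∧ chi (coprodIGens S) μ = ENNReal.ofReal ((∏ i, c i) / D) := by
  intro c D
  have := countable_coprodI (G := G)
  set χ := (chi (coprodIGens S) μ).toReal with hχdef
  have hc : ∀ i, 0 < c i := fun i => ENNReal.toReal_pos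
    (one_pos.trans_le (one_le_chi (hμi i))).ne' (chi_factor_ne_top hp hμ (hμi i) hχ)
  have hχ0 : 0 < χ := ENNReal.toReal_pos (one_pos.trans_le (one_le_chi hμ)).ne' hχ
  have hP : 0 < ∏ i, c i := Finset.prod_pos fun i _ => hc i
  have hmul : χ * D = ∏ i, c i := by
    have hj : ∀ j, χ * ∏ i ∈ Finset.univ.erase j, c i = (chiAvoids μ j).toReal * ∏ i, c i := by
      intro j
      rw [hχdef, toReal_chi_eq_mul hp hμ (hμi j),
        ← Finset.mul_prod_erase Finset.univ c (Finset.mem_univ j)]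
      ring
    have hsum := toReal_sum_chiAvoids hμ hχ
    simp only [D]
    rw [mul_sub, Finset.mul_sum, Finset.sum_congr rfl fun j _ => hj j, ← Finset.sum_mul]
    linear_combination (∏ i, c i) * hsum
  have hD : 0 < D := pos_of_mul_pos_right (hmul ▸ hP) hχ0.le
  refine ⟨hD, ?_⟩
  rw [← hmul, mul_div_cancel_right₀ _ hD.ne', hχdef, ENNReal.ofReal_toReal hχ]

lemma exists_setGens_ne_one {H : Type*} [Group H] [Nontrivial H] {T : Set H}
    (h : Subgroup.closure T = ⊤) : ∃ k, setGens T k ≠ 1 := by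
  by_contra! hT
  refine bot_ne_top (α := Subgroup H) (h ▸ ?_)
  exact ((Subgroup.closure_eq_bot_iff).2 fun x hx => hT ⟨x, hx⟩).symm

lemma chi_coprodIGens_one_eq_top [∀ i, Nontrivial (G i)] (hn : 2 ≤ n)
    (hgen : ∀ i, Subgroup.closure (S i) = ⊤) (hμ : IsBernoulli 1 μ)
    (hμi : ∀ i, IsBernoulli 1 (μi i)) : chi (coprodIGens S) μ = ⊤ := by
  by_contra hχ
  have h1 : (1 : ℝ) ∈ Icc (0 : ℝ) 1 := ⟨zero_le_one, le_rfl⟩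
  have hV : ∀ i, (chiAvoids μ i).toReal ≤ (chi (coprodIGens S) μ).toReal / 2 := by
    intro i
    obtain ⟨k, hk⟩ := exists_setGens_ne_one (hgen i)
    have h2 := ENNReal.toReal_mono (chi_factor_ne_top h1 hμ (hμi i) hχ) (two_le_chi (hμi i) hk)
    rw [ENNReal.toReal_ofNat] at h2
    rw [toReal_chi_eq_mul h1 hμ (hμi i)]
    linarith [mul_le_mul_of_nonneg_right h2 (ENNReal.toReal_nonneg (a := chiAvoids μ i))]
  have hsum := toReal_sum_chiAvoids hμ hχ
  have hle := Finset.sum_le_sum fun i (_ : i ∈ Finset.univ) => hV i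
  rw [Finset.sum_const, Finset.card_univ, Fintype.card_fin, nsmul_eq_mul] at hle
  have hn' : (2 : ℝ) ≤ n := by exact_mod_cast hn
  nlinarith [ENNReal.toReal_nonneg (a := chi (coprodIGens S) μ)]

end FreeProduct

end Perc

open Perc

/-- For `n ≥ 2` nontrivial finitely generated groups `Gᵢ` with finite
generating sets `Sᵢ`, and `0 ≤ p < p_c(G₁ * ⋯ * G_n)`: all `χᵢ(p)` are finite,
`D(p) = ∑_j ∏_{i≠j} χᵢ(p) - (n-1)·∏ᵢ χᵢ(p) > 0`, and the expected cluster size of the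
free product equals `∏ᵢ χᵢ(p) / D(p)`; moreover for `p_c ≤ p ≤ 1` it is infinite. -/
theorem expected_cluster_size_free_product
    {n : ℕ} (hn : 2 ≤ n) {G : Fin n → Type*} [∀ i, Group (G i)] [∀ i, Nontrivial (G i)]
    (S : ∀ i, Set (G i)) (hfin : ∀ i, (S i).Finite)
    (hgen : ∀ i, Subgroup.closure (S i) = ⊤)
    (μi : ∀ i, ℝ → Measure (Config (G i × S i)))
    (μ : ℝ → Measure (Config (Monoid.CoprodI G × (Σ i, S i))))
    (hμi : ∀ i, ∀ p ∈ Set.Icc (0 : ℝ) 1, IsBernoulli p (μi i p))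
    (hμ : ∀ p ∈ Set.Icc (0 : ℝ) 1, IsBernoulli p (μ p)) :
    (∀ p : ℝ, 0 ≤ p → p < pc (coprodIGens S) μ →
      (∀ i, chi (setGens (S i)) (μi i p) ≠ ⊤) ∧
      0 < (∑ j : Fin n, ∏ i ∈ Finset.univ.erase j, (chi (setGens (S i)) (μi i p)).toReal)
          - ((n : ℝ) - 1) * ∏ i : Fin n, (chi (setGens (S i)) (μi i p)).toReal ∧
      chi (coprodIGens S) (μ p) = ENNReal.ofReal
        ((∏ i : Fin n, (chi (setGens (S i)) (μi i p)).toReal) /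
          ((∑ j : Fin n, ∏ i ∈ Finset.univ.erase j, (chi (setGens (S i)) (μi i p)).toReal)
            - ((n : ℝ) - 1) * ∏ i : Fin n, (chi (setGens (S i)) (μi i p)).toReal))) ∧
    (∀ p : ℝ, pc (coprodIGens S) μ ≤ p → p ≤ 1 → chi (coprodIGens S) (μ p) = ⊤) := by
  have hG : ∀ i, Countable (G i) := fun i => countable_of_closure_eq_top (hfin i) (hgen i)
  have hS : ∀ i, Finite (S i) := fun i => (hfin i).to_subtype
  have := countable_coprodI (G := G)
  refine ⟨fun p hp hpc => ?_, fun p hpc hp1 => ?_⟩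
  · have hpI : p ∈ Set.Icc (0 : ℝ) 1 := ⟨hp, hpc.le.trans pc_le_one⟩
    have hχ := chi_ne_top_of_lt_pc hμ hp hpc
    exact ⟨fun i => chi_factor_ne_top (μi := fun i => μi i p) hpI (hμ p hpI) (hμi i p hpI) hχ,
      chi_coprodIGens_eq (μi := fun i => μi i p) hpI (hμ p hpI) (fun i => hμi i p hpI) hχ⟩
  · rcases hp1.lt_or_eq with hp1 | rfl
    · exact chi_eq_top_of_pc_le hμ hpc hp1
    · have h1 : (1 : ℝ) ∈ Set.Icc (0 : ℝ) 1 := ⟨zero_le_one, le_rfl⟩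
      exact chi_coprodIGens_one_eq_top hn hgen (hμ 1 h1) fun i => hμi i 1 h1
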